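/- arXiv:1305.1794 — 8 statements merged into one kernel-verified Lean document; each statement's English description precedes it below -/
import Mathlib

section
/- Suppose that Φ(μ, κ, λ) holds, that the topological space X is 𝒻-μ-compact and λ-compact and, in case λ is a singular cardinal, suppose further that X is cf(λ)-compact. Then X is 𝒻-κ-compact. -/
open Cardinal

universe u v w

/-- The Juhász–Szentmiklóssy principle `Φ(μ, κ, λ)`: there is a family
`{S ξ : ξ < λ}` of subsets of `κ`, each of cardinality `μ`, such that for every
`A ⊆ κ` with `|A| < κ`, the set `{ξ < λ : |A ∩ S ξ| = μ}` has cardinality `< λ`. -/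
def JSPhi (μ κ lam : Cardinal.{u}) : Prop :=
  ∃ S : lam.out → Set κ.out,
    (∀ ξ, #(S ξ) = μ) ∧
    ∀ A : Set κ.out, #A < κ →
      #{ξ : lam.out | #(↥(A ∩ S ξ)) = μ} < lam

/-- `x` is a complete accumulation point of a family `𝒴` of subsets of `X`:
`|{Y ∈ 𝒴 : Y ∩ U ≠ ∅}| = |𝒴|` for every neighborhood `U` of `x`. -/
def IsCapFamily {X : Type u} [TopologicalSpace X] (x : X) (𝒴 : Set (Set X)) : Prop :=
  ∀ U ∈ nhds x, #{Y : Set X | Y ∈ 𝒴 ∧ (Y ∩ U).Nonempty} = #𝒴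

/-- `x` is a complete accumulation point of a set `Y ⊆ X`:
`|Y ∩ U| = |Y|` for every neighborhood `U` of `x`. -/
def IsCapSet {X : Type u} [TopologicalSpace X] (x : X) (Y : Set X) : Prop :=
  ∀ U ∈ nhds x, #(↥(Y ∩ U)) = #Y

/-- `X` is `λ`-compact: every subset of `X` of cardinality `λ` has a complete
accumulation point. -/
def LamCompact (X : Type u) [TopologicalSpace X] (lam : Cardinal.{u}) : Prop :=
  ∀ Y : Set X, #Y = lam → ∃ x : X, IsCapSet x Y

/-- `X` is `𝒻`-`λ`-compact: every subfamily `𝒴 ⊆ 𝒻` of cardinality `λ` has a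
complete accumulation point. -/
def FamCompact {X : Type u} [TopologicalSpace X] (𝒻 : Set (Set X))
    (lam : Cardinal.{u}) : Prop :=
  ∀ 𝒴 ⊆ 𝒻, #𝒴 = lam → ∃ x : X, IsCapFamily x 𝒴

/-- If `X` is `θ`-compact and `q : ι → X` has a range of cardinality `θ = #ι`, then some point
of `X` has all its neighborhoods visited by `q` at `θ` many indices. -/
lemma LamCompact.exists_mk_preimage_eq_of_mk_range {X ι : Type u} [TopologicalSpace X]
    (h : LamCompact X #ι) (q : ι → X) (hq : #(Set.range q) = #ι) :
    ∃ x : X, ∀ U ∈ nhds x, #(q ⁻¹' U) = #ι := by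
  obtain ⟨x, hx⟩ := h _ hq
  refine ⟨x, fun U hU ↦ (mk_set_le _).antisymm ?_⟩
  rw [← hq, ← hx U hU, Set.inter_comm, ← Set.image_preimage_eq_inter_range]
  exact mk_image_le

/-- In a `θ`-compact space with `θ` regular, every `θ`-indexed family of points has a complete
accumulation point, counted with multiplicity. -/
lemma LamCompact.exists_mk_preimage_eq_of_isRegular {X ι : Type u} [TopologicalSpace X]
    (hι : Cardinal.IsRegular #ι) (h : LamCompact X #ι) (q : ι → X) :
    ∃ x : X, ∀ U ∈ nhds x, #(q ⁻¹' U) = #ι := by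
  rcases (mk_range_le (f := q)).eq_or_lt with hq | hq
  · exact h.exists_mk_preimage_eq_of_mk_range q hq
  obtain ⟨⟨x, _⟩, hx⟩ := infinite_pigeonhole (Set.rangeFactorization q) hι.aleph0_le
    (by rwa [hι.cof_ord])
  refine ⟨x, fun U hU ↦ (mk_set_le _).antisymm ?_⟩
  rw [← hx]
  refine mk_le_mk_of_subset fun i hi ↦ ?_
  have hi : q i = x := congrArg Subtype.val hi
  exact Set.mem_preimage.2 (hi ▸ mem_of_mem_nhds hU)

/-- If `p` has fewer than `#ι` values, its fibers have cardinalities unbounded below `#ι`. -/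
lemma exists_lt_mk_fiber_of_mk_range_lt {X ι : Type u} (hι : ℵ₀ < #ι) (p : ι → X)
    (hp : #(Set.range p) < #ι) {ν : Cardinal.{u}} (hν : ν < #ι) :
    ∃ y : X, ν < #(p ⁻¹' {y}) := by
  set θ := max ν (max #(Set.range p) ℵ₀)
  have hreg : Cardinal.IsRegular (Order.succ θ) :=
    isRegular_succ ((le_max_right _ _).trans (le_max_right _ _))
  obtain ⟨⟨y, _⟩, hy⟩ := infinite_pigeonhole_card (Set.rangeFactorization p) (Order.succ θ)
    (Order.succ_le_of_lt (max_lt hν (max_lt hp hι))) hreg.aleph0_le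
    (by
      rw [hreg.cof_ord, Order.lt_succ_iff]
      exact (le_max_left _ _).trans (le_max_right _ _))
  refine ⟨y, (Order.lt_succ_of_le (le_max_left _ _)).trans_le
    (hy.trans (mk_le_mk_of_subset fun i hi ↦ ?_))⟩
  exact congrArg Subtype.val hi

/-- A monotone family of cardinals below an infinite `c`, indexed by `cf c` and unbounded in `c`. -/
lemma exists_monotone_unbounded_lt {c : Cardinal.{u}} (hc : ℵ₀ ≤ c) :
    ∃ g : c.ord.cof.ord.ToType → Cardinal.{u},
      Monotone g ∧ (∀ i, g i < c) ∧ ∀ d < c, ∃ i, d ≤ g i := by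
  have hcof : Cardinal.IsRegular c.ord.cof := isRegular_cof (isSuccLimit_ord hc)
  obtain ⟨S, hS, hScard⟩ := Order.exists_cof_eq c.ord.ToType
  rw [Ordinal.cof_toType] at hScard
  obtain ⟨e⟩ : Nonempty (c.ord.cof.ord.ToType ≃ S) := by
    rw [← Cardinal.eq, hScard, mk_ord_toType]
  have hbdd (i) : BddAbove (Set.range fun j : Set.Iic i ↦ #(Set.Iio (e j.1).1)) :=
    bddAbove_of_small
  refine ⟨fun i ↦ ⨆ j : Set.Iic i, #(Set.Iio (e j.1).1), fun i i' hi ↦ ?_, fun i ↦ ?_,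
    fun d hd ↦ ?_⟩
  · exact ciSup_le' fun j ↦ le_ciSup (hbdd i') ⟨j.1, j.2.trans hi⟩
  · refine iSup_lt_of_lt_cof_ord ?_ fun j ↦ by simpa using mk_Iio_lt (e j.1).1 (by simp)
    simpa using mk_Iic_lt i (by simp) (by simpa using hcof.aleph0_le)
  · have hd' : d.ord < Ordinal.type (α := c.ord.ToType) (· < ·) := by
      simpa using hd
    obtain ⟨s, hs, hle⟩ := hS (Ordinal.enum (α := c.ord.ToType) (· < ·) ⟨d.ord, hd'⟩)
    refine ⟨e.symm ⟨s, hs⟩, le_trans ?_ (le_ciSup (hbdd _) ⟨_, Set.self_mem_Iic⟩)⟩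
    rw [e.apply_symm_apply]
    refine le_trans ?_ (mk_le_mk_of_subset (Set.Iio_subset_Iio hle))
    have h := Ordinal.card_typein (r := ((· < ·) : c.ord.ToType → _ → Prop))
      (Ordinal.enum (α := c.ord.ToType) (· < ·) ⟨d.ord, hd'⟩)
    rw [Ordinal.typein_enum, card_ord] at h
    exact h.le

/-- In a `θ`-compact space, which is also `cf θ`-compact if `θ` is singular, every `θ`-indexed family
of points has a complete accumulation point, counted with multiplicity. -/
lemma LamCompact.exists_mk_preimage_eq {X ι : Type u} [TopologicalSpace X]
    (hι : ℵ₀ ≤ #ι) (h : LamCompact X #ι)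
    (hcf : ¬ Cardinal.IsRegular #ι → LamCompact X (#ι).ord.cof) (p : ι → X) :
    ∃ x : X, ∀ U ∈ nhds x, #(p ⁻¹' U) = #ι := by
  by_cases hreg : Cardinal.IsRegular #ι
  · exact h.exists_mk_preimage_eq_of_isRegular hreg p
  rcases (mk_range_le (f := p)).eq_or_lt with hp | hp
  · exact h.exists_mk_preimage_eq_of_mk_range p hp
  have hι' : ℵ₀ < #ι := hι.lt_of_ne fun h ↦ hreg (h ▸ isRegular_aleph0)
  have hcof : Cardinal.IsRegular (#ι).ord.cof := isRegular_cof (isSuccLimit_ord hι)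
  obtain ⟨g, hmono, hlt, hunb⟩ := exists_monotone_unbounded_lt hι
  choose y hy using fun i ↦ exists_lt_mk_fiber_of_mk_range_lt hι' p hp (hlt i)
  have hmk := mk_ord_toType (#ι).ord.cof
  obtain ⟨x, hx⟩ := LamCompact.exists_mk_preimage_eq_of_isRegular
    (by rwa [hmk]) (by rw [hmk]; exact hcf hreg) y
  refine ⟨x, fun U hU ↦ (mk_set_le _).eq_of_not_lt fun hUlt ↦ ?_⟩
  obtain ⟨j, hj⟩ := hunb _ hUlt
  obtain ⟨i, hiU, hi⟩ : ∃ i ∈ y ⁻¹' U, i ∉ Set.Iio j := by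
    by_contra! hsub
    refine (mk_Iio_lt j (by simp)).not_ge ?_
    exact (hx U hU).ge.trans (mk_le_mk_of_subset hsub)
  refine ((hj.trans (hmono (not_lt.1 hi))).trans_lt (hy i)).not_ge (mk_le_mk_of_subset ?_)
  exact Set.preimage_mono (Set.singleton_subset_iff.2 hiU)

/-- Theorem 2.1 (Theorem `js2`): if `Φ(μ, κ, λ)` holds, `X` is `𝒻`-`μ`-compact
and `λ`-compact and, in case `λ` is singular, also `cf λ`-compact, then `X` is
`𝒻`-`κ`-compact. -/
theorem js2 {X : Type u} [TopologicalSpace X]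
    (𝒻 : Set (Set X)) (h𝒻ne : 𝒻.Nonempty) (h𝒻 : ∅ ∉ 𝒻)
    (μ κ lam : Cardinal.{u}) (hμ : ℵ₀ ≤ μ) (hκ : ℵ₀ ≤ κ) (hlam : ℵ₀ ≤ lam)
    (hPhi : JSPhi μ κ lam)
    (hFμ : FamCompact 𝒻 μ)
    (hlamc : LamCompact X lam)
    (hcf : ¬ lam.IsRegular → LamCompact X lam.ord.cof) :
    FamCompact 𝒻 κ := by
  obtain ⟨S, hS, hSA⟩ := hPhi
  intro 𝒴 h𝒴 hcard
  obtain ⟨e⟩ : Nonempty (κ.out ≃ 𝒴) := by rw [← Cardinal.eq, mk_out, hcard]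
  let f : κ.out → Set X := fun α ↦ (e α).1
  have hf : Function.Injective f := Subtype.val_injective.comp e.injective
  have hfmem (α) : f α ∈ 𝒴 := (e α).2
  have hacc (ξ : lam.out) : ∃ x : X, IsCapFamily x (f '' S ξ) :=
    hFμ _ ((Set.image_subset_iff.2 fun α _ ↦ hfmem α).trans h𝒴) (by rw [mk_image_eq hf, hS])
  choose p hp using hacc
  obtain ⟨x, hx⟩ := LamCompact.exists_mk_preimage_eq (by rwa [mk_out])
    (by rwa [mk_out]) (by rwa [mk_out]) p
  rw [mk_out] at hx
  refine ⟨x, fun U hU ↦ (mk_le_mk_of_subset fun Y hY ↦ hY.1).eq_of_not_lt fun hlt ↦ ?_⟩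
  set A : Set κ.out := {α | (f α ∩ interior U).Nonempty}
  have hA : #A < κ := by
    refine (mk_image_eq hf (s := A)).ge.trans_lt (lt_of_le_of_lt (mk_le_mk_of_subset ?_)
      (hlt.trans_eq hcard))
    rintro _ ⟨α, hα, rfl⟩
    exact ⟨hfmem α, hα.mono (Set.inter_subset_inter_right _ interior_subset)⟩
  refine (hSA A hA).not_ge ?_
  refine (hx _ (interior_mem_nhds.2 hU)).ge.trans (mk_le_mk_of_subset fun ξ hξ ↦ ?_)
  have h := hp ξ _ (isOpen_interior.mem_nhds hξ)
  rw [mk_image_eq hf, hS] at h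
  rw [Set.mem_ofPred_eq, ← h, ← mk_image_eq hf]
  congr! 2
  ext Y
  constructor
  · rintro ⟨α, ⟨hα, hαS⟩, rfl⟩
    exact ⟨⟨α, hαS, rfl⟩, hα⟩
  · rintro ⟨⟨α, hαS, rfl⟩, hα⟩
    exact ⟨α, ⟨hα, hαS⟩, rfl⟩
end

section
/- Suppose that Φ(μ, κ, λ) holds, that the topological space X is λ-compact and, in case λ is singular, suppose further that X is cf(λ)-compact. If 𝒴 is a family of subsets of X with |𝒴| = κ, and every subfamily of 𝒴 of cardinality μ has a complete accumulation point, then 𝒴 has a complete accumulation point. -/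
open Cardinal

universe u v w

open Set in
/-- If `f` has fewer than `#ι` values and all its fibers are smaller than `#ι`, then there are
`cof #ι` values such that the fibers over any `cof #ι` of them have unbounded size below `#ι`. -/
theorem exists_set_fibers_unbounded {ι X : Type u} (hι : ℵ₀ ≤ #ι) (f : ι → X)
    (hrange : #(range f) < #ι) (hfib : ∀ y, #(f ⁻¹' {y}) < #ι) :
    ∃ T : Set X, #T = (#ι).ord.cof ∧
      ∀ V ⊆ T, #V = (#ι).ord.cof → ∀ c < #ι, ∃ y ∈ V, c < #(f ⁻¹' {y}) := by
  have hlarge : ∀ c < #ι, ∃ y, c < #(f ⁻¹' {y}) := by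
    intro c hc
    by_contra! h
    have hcover : (⋃ y : range f, f ⁻¹' {(y : X)}) = Set.univ := by
      ext i
      simp
    have hle : #ι ≤ #(range f) * c := by
      calc #ι = #(⋃ y : range f, f ⁻¹' {(y : X)}) := by rw [hcover, mk_univ]
        _ ≤ #(range f) * ⨆ y : range f, #(f ⁻¹' {(y : X)}) := mk_iUnion_le _
        _ ≤ #(range f) * c := by
          gcongr
          exact ciSup_le' fun y => h y
    exact (mul_lt_of_lt hι hrange hc).not_ge hle
  obtain ⟨_, _, hord⟩ := exists_ord_eq_type_lt ι
  have hcof : (#ι).ord.cof = Order.cof ι := by rw [hord, Ordinal.cof_type]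
  obtain ⟨s, hs, hst⟩ := Ordinal.exists_ord_cof_eq ι
  have hscard : #s = Order.cof ι := by
    rw [← card_ord (Order.cof ι), ← hst, Ordinal.card_type]
  have hsord : (#s).ord = Ordinal.type (α := s) (· < ·) := by rw [hst, hscard]
  have hIio : ∀ i : ι, #(Iio i) < #ι := fun i => mk_Iio_lt i hord
  have hbig : ∀ c < #ι, ∃ i : ι, c ≤ #(Iio i) := by
    intro c hc
    have hlt : c.ord < Ordinal.type (α := ι) (· < ·) := by rwa [← hord, ord_lt_ord]
    obtain ⟨i, hi⟩ := Ordinal.typein_surj (α := ι) (· < ·) hlt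
    refine ⟨i, ?_⟩
    have := congrArg Ordinal.card hi
    rw [card_ord] at this
    exact this.ge
  have hcofinal : ∀ c < #ι, ∃ o : s, c ≤ #(Iio (o : ι)) := by
    intro c hc
    obtain ⟨i, hi⟩ := hbig c hc
    obtain ⟨o, hos, hio⟩ := hs i
    exact ⟨⟨o, hos⟩, hi.trans (mk_le_mk_of_subset (Iio_subset_Iio hio))⟩
  choose t ht using fun o : s => hlarge _ (hIio o)
  have hT : #(range t) = (#ι).ord.cof := by
    refine le_antisymm (mk_range_le.trans_eq (hscard.trans hcof.symm)) ?_
    by_contra! hlt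
    obtain ⟨o, ho⟩ := hcofinal _
      (iSup_lt_of_lt_cof_ord hlt fun y : range t => hfib (y : X))
    have hle := le_ciSup (bddAbove_of_small (s := range fun y : range t => #(f ⁻¹' {(y : X)})))
      ⟨t o, mem_range_self o⟩
    exact (ht o).not_ge (hle.trans ho)
  refine ⟨range t, hT, fun V hV hVcard c hc => ?_⟩
  by_contra! hsmall
  obtain ⟨o, ho⟩ := hcofinal c hc
  have hsub : V ⊆ t '' Iio o := by
    intro y hy
    obtain ⟨o', rfl⟩ := hV hy
    refine ⟨o', ?_, rfl⟩
    by_contra hoo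
    have hle : (o : ι) ≤ o' := not_lt.mp hoo
    exact (ht o').not_ge
      ((hsmall _ hy).trans (ho.trans (mk_le_mk_of_subset (Iio_subset_Iio hle))))
  refine (((mk_le_mk_of_subset hsub).trans mk_image_le).trans_lt
    (mk_Iio_lt o hsord)).ne ?_
  rw [hVcard, hcof, hscard]

open Set in
/-- In a space that is `#ι`-compact, and `cof #ι`-compact if `#ι` is singular, every family of
points indexed by `ι` has a complete accumulation point, counted with multiplicities. -/
theorem exists_forall_mk_preimage_eq {ι X : Type u} [TopologicalSpace X] (hι : ℵ₀ ≤ #ι)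
    (hcomp : LamCompact X #ι) (hcof : ¬ (#ι).IsRegular → LamCompact X (#ι).ord.cof)
    (f : ι → X) : ∃ p : X, ∀ U ∈ nhds p, #(f ⁻¹' U) = #ι := by
  suffices h : ∃ p : X, ∀ U ∈ nhds p, #ι ≤ #(f ⁻¹' U) by
    obtain ⟨p, hp⟩ := h
    exact ⟨p, fun U hU => (mk_set_le _).antisymm (hp U hU)⟩
  by_cases hfib : ∃ p, #ι ≤ #(f ⁻¹' {p})
  · obtain ⟨p, hp⟩ := hfib
    refine ⟨p, fun U hU => hp.trans (mk_le_mk_of_subset (preimage_mono ?_))⟩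
    exact singleton_subset_iff.mpr (mem_of_mem_nhds hU)
  push Not at hfib
  rcases (mk_range_le (f := f)).lt_or_eq with hrange | hrange
  · have hcof' : LamCompact X (#ι).ord.cof := by
      by_cases hreg : (#ι).IsRegular
      · rwa [hreg.cof_ord]
      · exact hcof hreg
    obtain ⟨T, hT, hunb⟩ := exists_set_fibers_unbounded hι f hrange hfib
    obtain ⟨p, hp⟩ := hcof' T hT
    refine ⟨p, fun U hU => ?_⟩
    by_contra! hlt
    obtain ⟨y, hy, hlty⟩ := hunb _ inter_subset_left ((hp U hU).trans hT) _ hlt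
    exact hlty.not_ge
      (mk_le_mk_of_subset (preimage_mono (singleton_subset_iff.mpr hy.2)))
  · obtain ⟨p, hp⟩ := hcomp (range f) hrange
    refine ⟨p, fun U hU => ?_⟩
    calc #ι = #(↥(range f ∩ U)) := by rw [hp U hU, hrange]
      _ = #(f '' (f ⁻¹' U)) := by rw [image_preimage_eq_range_inter]
      _ ≤ #(f ⁻¹' U) := mk_image_le

/-- Corollary 2.2 (first part): if `Φ(μ, κ, λ)` holds, `X` is `λ`-compact (and
`cf λ`-compact in case `λ` is singular), `𝒴` is a family of subsets of `X` of
cardinality `κ`, and every subfamily of `𝒴` of cardinality `μ` has a complete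
accumulation point, then `𝒴` has a complete accumulation point. -/
theorem local_family {X : Type u} [TopologicalSpace X]
    (μ κ lam : Cardinal.{u}) (hμ : ℵ₀ ≤ μ) (hκ : ℵ₀ ≤ κ) (hlam : ℵ₀ ≤ lam)
    (hPhi : JSPhi μ κ lam)
    (hlamc : LamCompact X lam)
    (hcf : ¬ lam.IsRegular → LamCompact X lam.ord.cof)
    (𝒴 : Set (Set X)) (h𝒴 : #𝒴 = κ)
    (hsub : ∀ 𝒵 ⊆ 𝒴, #𝒵 = μ → ∃ x : X, IsCapFamily x 𝒵) :
    ∃ x : X, IsCapFamily x 𝒴 := by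
  obtain ⟨S, hS, hsmall⟩ := hPhi
  obtain ⟨e⟩ : Nonempty (κ.out ≃ 𝒴) := Cardinal.eq.mp (by rw [mk_out, h𝒴])
  have he : Function.Injective fun i => (e i : Set X) :=
    Subtype.val_injective.comp e.injective
  choose f hf using fun ξ => hsub ((fun i => (e i : Set X)) '' S ξ)
    (by rintro _ ⟨i, -, rfl⟩; exact (e i).2) (by rw [mk_image_eq he, hS])
  obtain ⟨p, hp⟩ := exists_forall_mk_preimage_eq (ι := lam.out) (by rwa [mk_out])
    (by rwa [mk_out]) (by rwa [mk_out]) f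
  refine ⟨p, fun U hU => ?_⟩
  refine (mk_le_mk_of_subset fun Y hY => hY.1).antisymm ?_
  by_contra! hlt
  let A : Set κ.out := {i | ((e i : Set X) ∩ interior U).Nonempty}
  have hA : #A < κ := by
    refine (mk_image_eq he).symm.trans_lt
      ((mk_le_mk_of_subset ?_).trans_lt (hlt.trans_eq h𝒴))
    rintro _ ⟨i, hi, rfl⟩
    exact ⟨(e i).2, hi.mono (Set.inter_subset_inter_right _ interior_subset)⟩
  refine (hsmall A hA).not_ge ?_
  refine ((hp _ (interior_mem_nhds.mpr hU)).trans (mk_out lam)).symm.trans_le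
    (mk_le_mk_of_subset fun ξ hξ => ?_)
  have hcap := hf ξ (interior U) (isOpen_interior.mem_nhds hξ)
  rw [mk_image_eq he, hS] at hcap
  change #(↥(A ∩ S ξ)) = μ
  rw [← hcap, ← mk_image_eq (s := A ∩ S ξ) he]
  congr 2
  ext Y
  constructor
  · rintro ⟨i, ⟨hiA, hiS⟩, rfl⟩
    exact ⟨⟨i, hiS, rfl⟩, hiA⟩
  · rintro ⟨⟨i, hiS, rfl⟩, hiA⟩
    exact ⟨i, ⟨hiA, hiS⟩, rfl⟩
end

section
/- If the topological space X is linearly Lindelöf and 𝒻-ℵ_ω-compact, then X is 𝒻-κ-compact for every uncountable cardinal κ. -/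
open Cardinal

universe u v w

/-- `X` is linearly Lindelöf: `X` is `λ`-compact for every regular uncountable
cardinal `λ`. -/
def LinearlyLindelof (X : Type u) [TopologicalSpace X] : Prop :=
  ∀ lam : Cardinal.{u}, lam.IsRegular → ℵ₀ < lam → LamCompact X lam

lemma mk_Iio_ord_lt {κ : Cardinal.{u}} (i : κ.ord.ToType) : #(Set.Iio i) < κ := by
  simpa using Cardinal.mk_Iio_lt i

lemma exists_le_mk_Iio {κ c : Cardinal.{u}} (hc : c < κ) :
    ∃ g : κ.ord.ToType, c ≤ #(Set.Iio g) := by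
  have h : c.ord < Ordinal.type (α := κ.ord.ToType) (· < ·) := by simpa using hc
  obtain ⟨g, hg⟩ := Ordinal.typein_surj _ h
  refine ⟨g, ?_⟩
  have := Ordinal.card_typein (r := ((· < ·) : κ.ord.ToType → κ.ord.ToType → Prop)) g
  rw [hg, Cardinal.card_ord] at this
  exact this.le

lemma mk_sigma_nat_le {L : ℕ → Type u} {κ : Cardinal.{u}} (hκ : ℵ₀ ≤ κ) (h : ∀ n, #(L n) ≤ κ) :
    #(Σ n, L n) ≤ κ := by
  rw [Cardinal.mk_sigma]
  refine (Cardinal.sum_le_sum _ (fun _ => κ) h).trans ?_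
  rw [Cardinal.sum_const]
  simpa using Cardinal.mul_le_of_le hκ hκ le_rfl

open Set in
/-- In a relation where countable sets are bounded but the whole type is not, there is a family of
uncountable regular size such that every element bounds strictly fewer members than that. -/
lemma exists_regular_unbounded_family {P : Type u} (r : P → P → Prop) [IsTrans P r]
    (hc : ∀ s : Set P, s.Countable → ∃ g, ∀ f ∈ s, r f g) (hu : ¬ ∃ g, ∀ f, r f g) :
    ∃ (ι : Type u) (f : ι → P), (#ι).IsRegular ∧ ℵ₀ < #ι ∧ ∀ g, #{i | r (f i) g} < #ι := by
  obtain ⟨μ, ⟨s, hsμ, hs⟩, hmin⟩ := Cardinal.lt_wf.has_min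
    {μ : Cardinal.{u} | ∃ s : Set P, #s = μ ∧ ¬ ∃ g, ∀ f ∈ s, r f g}
    ⟨_, Set.univ, rfl, by simpa using hu⟩
  have hsmall : ∀ t : Set P, #t < μ → ∃ g, ∀ f ∈ t, r f g := by
    intro t ht
    by_contra h
    exact hmin _ ⟨t, rfl, h⟩ ht
  have hμ : ℵ₀ < μ := by
    by_contra! h
    exact hs (hc s (by rwa [← Cardinal.le_aleph0_iff_set_countable, hsμ]))
  have hcard : #μ.ord.ToType = μ := by simp
  obtain ⟨e⟩ : Nonempty (μ.ord.ToType ≃ s) := Cardinal.eq.1 (by rw [hcard, hsμ])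
  have hinit : ∀ i : μ.ord.ToType, ∃ g, ∀ j ≤ i, r (e j) g := by
    intro i
    obtain ⟨g, hg⟩ := hsmall ((fun j => (e j : P)) '' Iic i)
      (Cardinal.mk_image_le.trans_lt (by
        have := mk_Iio_ord_lt i
        rw [← Iio_insert]
        refine (Cardinal.mk_insert_le).trans_lt ?_
        exact Cardinal.add_lt_of_lt hμ.le this (Cardinal.one_lt_aleph0.trans hμ)))
    exact ⟨g, fun j hj => hg _ ⟨j, hj, rfl⟩⟩
  choose f hf using hinit
  have key : ∀ (g : P) (C : Set μ.ord.ToType), IsCofinal C → ¬ ∀ i ∈ C, r (f i) g := by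
    intro g C hC h
    refine hs ⟨g, fun y hy => ?_⟩
    obtain ⟨i, hi, hji⟩ := hC (e.symm ⟨y, hy⟩)
    have := hf i _ hji
    simp only [Equiv.apply_symm_apply] at this
    exact _root_.trans this (h i hi)
  refine ⟨μ.ord.ToType, f, ?_, by rwa [hcard], fun g => ?_⟩
  · rw [hcard]
    refine ⟨hμ.le, ?_⟩
    by_contra! hlt
    obtain ⟨C, hC, hCc⟩ := Order.exists_cof_eq μ.ord.ToType
    obtain ⟨g, hg⟩ := hsmall (f '' C) (Cardinal.mk_image_le.trans_lt (by
      rwa [hCc, Ordinal.cof_toType]))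
    exact key g C hC fun i hi => hg _ ⟨i, hi, rfl⟩
  · rw [hcard]
    by_contra! h
    refine key g {i | r (f i) g} ?_ fun i hi => hi
    by_contra hC
    rw [not_isCofinal_iff] at hC
    obtain ⟨x, hx⟩ := hC
    have : {i | r (f i) g} ⊆ Iio x := fun i hi => hx i hi
    exact (h.trans (Cardinal.mk_le_mk_of_subset this)).not_gt (mk_Iio_ord_lt x)

lemma exists_forall_lt_of_mk_lt_cof {α : Type u} [LinearOrder α] {s : Set α}
    (h : #s < Order.cof α) : ∃ x, ∀ y ∈ s, y < x := by
  by_contra hC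
  rw [← not_isCofinal_iff, not_not] at hC
  exact (Order.cof_le hC).not_gt h

/-- A singular cardinal of countable cofinality carries regular uncountably many sequences such
that each small set contains few of them. -/
lemma exists_sequences_of_cof_eq_aleph0 {κ : Cardinal.{u}} (hκ : κ.IsSingular)
    (hcof : κ.ord.cof = ℵ₀) :
    ∃ (α ι : Type u) (f : ι → ℕ → α), #α ≤ κ ∧ (#ι).IsRegular ∧ ℵ₀ < #ι ∧
      ∀ S : Set α, #S < κ → #{i | ∀ n, f i n ∈ S} < #ι := by
  obtain ⟨C, hC, hCc⟩ := Order.exists_cof_eq κ.ord.ToType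
  rw [Ordinal.cof_toType, hcof] at hCc
  have hκ0 : ℵ₀ ≤ κ := hκ.aleph0_le
  have hsucc : ∀ d < κ, Order.succ d < κ := fun d hd => hκ.isSuccLimit.succ_lt hd
  obtain ⟨e⟩ : Nonempty (ULift.{u} ℕ ≃ C) := Cardinal.eq.1 (by simp [hCc])
  let a : ℕ → κ.ord.ToType := partialSups fun n => (e ⟨n⟩ : κ.ord.ToType)
  let d : ℕ → Cardinal.{u} := fun n => max ℵ₀ #(Set.Iio (a n))
  have hd0 : ∀ n, ℵ₀ ≤ d n := fun n => le_max_left _ _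
  have hdκ : ∀ n, Order.succ (d n) < κ := fun n => hsucc _
    (max_lt (hcof ▸ hκ.cof_ord_lt) (mk_Iio_ord_lt _))
  have hdcof : ∀ c < κ, ∀ᶠ n in Filter.atTop, c < Order.succ (d n) := by
    intro c hc
    obtain ⟨g, hg⟩ := exists_le_mk_Iio hc
    obtain ⟨y, hy, hgy⟩ := hC g
    filter_upwards [Filter.eventually_ge_atTop (e.symm ⟨y, hy⟩).down] with n hn
    have hya : y ≤ a n := by
      have := le_partialSups_of_le (fun n => (e ⟨n⟩ : κ.ord.ToType)) hn
      rwa [ULift.up_down, Equiv.apply_symm_apply] at this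
    exact Order.lt_succ_of_le <| hg.trans <|
      (Cardinal.mk_le_mk_of_subset (Set.Iio_subset_Iio (hgy.trans hya))).trans (le_max_right _ _)
  have hreg : ∀ n, (Order.succ (d n)).IsRegular := fun n => isRegular_succ (hd0 n)
  let L : ℕ → Type u := fun n => (Order.succ (d n)).ord.ToType
  have hLcof : ∀ n, Order.cof (L n) = Order.succ (d n) := fun n => by
    rw [Ordinal.cof_toType, (hreg n).cof_ord]
  let r : (∀ n, L n) → (∀ n, L n) → Prop := fun f g => ∀ᶠ n in Filter.atTop, f n ≤ g n
  have : IsTrans _ r := ⟨fun f g h hfg hgh => by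
    filter_upwards [hfg, hgh] with n h1 h2 using h1.trans h2⟩
  have hbound : ∀ n (s : Set (L n)), #s < Order.succ (d n) → ∃ x, ∀ y ∈ s, y < x :=
    fun n s hs => exists_forall_lt_of_mk_lt_cof (by rwa [hLcof])
  obtain ⟨ι, f, h1, h2, h3⟩ := exists_regular_unbounded_family r
    (by
      intro s hs
      have : ∀ n, ∃ x : L n, ∀ y ∈ (fun f => f n) '' s, y < x := fun n => hbound n _ (by
        refine lt_of_le_of_lt ?_ (Order.lt_succ_of_le (hd0 n))
        rw [Cardinal.le_aleph0_iff_set_countable]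
        exact hs.image _)
      choose g hg using this
      exact ⟨g, fun f hf => Filter.Eventually.of_forall fun n => (hg n _ ⟨f, hf, rfl⟩).le⟩)
    (by
      rintro ⟨g, hg⟩
      have : ∀ n, ∃ x : L n, ∀ y ∈ ({g n} : Set (L n)), y < x := fun n => hbound n _ (by
        rw [Cardinal.mk_singleton]
        exact Cardinal.one_lt_aleph0.trans_le ((hd0 n).trans (Order.le_succ _)))
      choose h hh using this
      obtain ⟨n, hn⟩ := (hg h).exists
      exact (hh n (g n) rfl).not_ge hn)
  refine ⟨Σ n, L n, ι, fun i n => ⟨n, f i n⟩, ?_, h1, h2, ?_⟩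
  · exact mk_sigma_nat_le hκ0 fun n => by simpa [L] using (hdκ n).le
  · intro S hS
    have : ∀ n, ∃ x : L n, #S < Order.succ (d n) → ∀ y : L n, ⟨n, y⟩ ∈ S → y < x := by
      intro n
      by_cases hn : #S < Order.succ (d n)
      · obtain ⟨x, hx⟩ := hbound n {y | ⟨n, y⟩ ∈ S} (lt_of_le_of_lt
          (Cardinal.mk_le_of_injective (f := fun y : {y | (⟨n, y⟩ : Σ n, L n) ∈ S} => (⟨⟨n, y.1⟩, y.2⟩ : S)) (by
            rintro ⟨y, _⟩ ⟨z, _⟩ h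
            simpa using h)) hn)
        exact ⟨x, fun _ => hx⟩
      · obtain ⟨x, -⟩ := hbound n ∅ (by simp)
        exact ⟨x, fun h => absurd h hn⟩
    choose g hg using this
    refine lt_of_le_of_lt (Cardinal.mk_le_mk_of_subset ?_) (h3 g)
    intro i hi
    filter_upwards [hdcof _ hS] with n hn using (hg n hn _ (hi n)).le

/-- `ℵ_ω` is the size of a countable increasing union of smaller sets. -/
lemma exists_rank_aleph_omega0 : ∃ (W : Type u) (ρ : W → ℕ), #W = ℵ_ Ordinal.omega0 ∧
    ∀ N, #{w | ρ w < N} < ℵ_ Ordinal.omega0 := by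
  have hle : ∀ n : ℕ, ℵ_ (n : Ordinal.{u}) < ℵ_ Ordinal.omega0 := fun n => by
    rw [Cardinal.aleph_lt_aleph]
    exact Ordinal.natCast_lt_omega0 n
  refine ⟨Σ n : ℕ, (ℵ_ (n : Ordinal.{u})).out, Sigma.fst, le_antisymm ?_ ?_, fun N => ?_⟩
  · exact mk_sigma_nat_le (Cardinal.aleph0_le_aleph _) fun n => by simpa using (hle n).le
  · rw [Cardinal.aleph_limit Ordinal.isSuccLimit_omega0]
    refine ciSup_le' ?_
    rintro ⟨o, ho⟩
    obtain ⟨n, rfl⟩ := Ordinal.lt_omega0.1 ho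
    simpa using Cardinal.mk_le_of_injective
      (sigma_mk_injective (β := fun n : ℕ => (ℵ_ (n : Ordinal.{u})).out) (i := n))
  · induction N with
    | zero => simpa using Cardinal.aleph_pos _
    | succ N ih =>
      have hsub : {w : Σ n : ℕ, (ℵ_ (n : Ordinal.{u})).out | w.1 < N + 1} ⊆
          {w | w.1 < N} ∪ Set.range (Sigma.mk N) := by
        rintro ⟨n, w⟩ hn
        rcases (Nat.lt_succ_iff_lt_or_eq.1 hn) with h | h
        · exact Or.inl h
        · obtain rfl : n = N := h
          exact Or.inr ⟨w, rfl⟩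
      refine ((Cardinal.mk_le_mk_of_subset hsub).trans (Cardinal.mk_union_le _ _)).trans_lt ?_
      refine Cardinal.add_lt_of_lt (Cardinal.aleph0_le_aleph _) ih ?_
      refine Cardinal.mk_range_le.trans_lt ?_
      simp [hle N]

section LinearlyLindelof

variable {X : Type u} [TopologicalSpace X]

/-- Indexed version of `LamCompact`, where the points may repeat. -/
lemma LinearlyLindelof.exists_forall_mk_eq (hLL : LinearlyLindelof X) {ι : Type u} (p : ι → X)
    (hreg : (#ι).IsRegular) (hι : ℵ₀ < #ι) : ∃ x, ∀ U ∈ nhds x, #{i | p i ∈ U} = #ι := by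
  by_cases h : #(Set.range p) = #ι
  · obtain ⟨x, hx⟩ := hLL _ hreg hι _ h
    refine ⟨x, fun U hU => le_antisymm (Cardinal.mk_set_le _) ?_⟩
    rw [← h, ← hx U hU]
    refine Cardinal.mk_le_of_surjective (f := fun i : {i | p i ∈ U} =>
      (⟨p i, ⟨i, rfl⟩, i.2⟩ : ↥(Set.range p ∩ U))) ?_
    rintro ⟨_, ⟨i, rfl⟩, hi⟩
    exact ⟨⟨i, hi⟩, rfl⟩
  · have hlt : #(Set.range p) < #ι := lt_of_le_of_ne Cardinal.mk_range_le h
    obtain ⟨⟨x, hx⟩, hp⟩ := Cardinal.infinite_pigeonhole (Set.rangeFactorization p) hι.le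
      (by rwa [hreg.cof_ord])
    refine ⟨x, fun U hU => le_antisymm (Cardinal.mk_set_le _) ?_⟩
    rw [← hp]
    refine Cardinal.mk_le_mk_of_subset fun i hi => ?_
    have : p i = x := congrArg Subtype.val hi
    simpa [this] using mem_of_mem_nhds hU

lemma LinearlyLindelof.famCompact_of_isRegular (hLL : LinearlyLindelof X) {𝒻 : Set (Set X)}
    (h𝒻 : ∅ ∉ 𝒻) {κ : Cardinal.{u}} (hreg : κ.IsRegular) (hκ : ℵ₀ < κ) : FamCompact 𝒻 κ := by
  intro 𝒴 h𝒴 hcard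
  have hne : ∀ Y : 𝒴, (Y : Set X).Nonempty := fun Y => Set.nonempty_iff_ne_empty.2 fun h =>
    h𝒻 (h ▸ h𝒴 Y.2)
  choose p hp using hne
  obtain ⟨x, hx⟩ := hLL.exists_forall_mk_eq p (by rwa [hcard]) (by rwa [hcard])
  refine ⟨x, fun U hU => le_antisymm (Cardinal.mk_le_mk_of_subset fun Y hY => hY.1) ?_⟩
  rw [← hx U hU]
  exact Cardinal.mk_le_of_injective
    (f := fun Y => (⟨Y.1.1, Y.1.2, p Y.1, hp Y.1, Y.2⟩ : {Y | Y ∈ 𝒴 ∧ (Y ∩ U).Nonempty}))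
    fun Y Z h => Subtype.ext (Subtype.ext (Subtype.mk.inj h))

/-- It suffices to refute that every point has an open neighborhood meeting few members. -/
lemma exists_isCapFamily_of_isOpen {𝒴 : Set (Set X)} {κ : Cardinal.{u}} (hcard : #𝒴 = κ)
    (h : ¬ ∀ x : X, ∃ U, IsOpen U ∧ x ∈ U ∧ #{Y | Y ∈ 𝒴 ∧ (Y ∩ U).Nonempty} < κ) :
    ∃ x : X, IsCapFamily x 𝒴 := by
  push Not at h
  obtain ⟨x, hx⟩ := h
  refine ⟨x, fun U hU => le_antisymm (Cardinal.mk_le_mk_of_subset fun Y hY => hY.1) ?_⟩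
  obtain ⟨V, hVU, hV, hxV⟩ := mem_nhds_iff.1 hU
  rw [hcard]
  exact (hx V hV hxV).trans (Cardinal.mk_le_mk_of_subset fun Y hY =>
    ⟨hY.1, hY.2.mono (Set.inter_subset_inter_right _ hVU)⟩)

lemma LinearlyLindelof.famCompact_of_aleph0_lt_cof (hLL : LinearlyLindelof X) {𝒻 : Set (Set X)}
    (h𝒻 : ∅ ∉ 𝒻) {κ : Cardinal.{u}} (hκ : κ.IsSingular) (hcof : ℵ₀ < κ.ord.cof) :
    FamCompact 𝒻 κ := by
  intro 𝒴 h𝒴 hcard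
  refine exists_isCapFamily_of_isOpen hcard fun hO => ?_
  have hsucc : ∀ d < κ, Order.succ d < κ := fun d hd => hκ.isSuccLimit.succ_lt hd
  have hκ0 : ℵ₀ < κ := hcof.trans_le (Ordinal.cof_ord_le κ)
  obtain ⟨ι, f, hreg, hι, hf⟩ := exists_regular_unbounded_family
    (fun a b : κ.ord.ToType => a ≤ b)
    (fun s hs => by
      obtain ⟨x, hx⟩ := exists_forall_lt_of_mk_lt_cof (s := s) (by
        rw [Ordinal.cof_toType]
        exact (Cardinal.le_aleph0_iff_set_countable.2 hs).trans_lt hcof)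
      exact ⟨x, fun y hy => (hx y hy).le⟩)
    (by
      rintro ⟨g, hg⟩
      obtain ⟨x, hx⟩ := exists_forall_lt_of_mk_lt_cof (s := {g}) (by
        rw [Ordinal.cof_toType, Cardinal.mk_singleton]
        exact Cardinal.one_lt_aleph0.trans hcof)
      exact (hx g rfl).not_ge (hg x))
  have hx : ∀ i, ∃ x : X, ∀ U ∈ nhds x,
      #(Set.Iio (f i)) < #{Y | Y ∈ 𝒴 ∧ (Y ∩ U).Nonempty} := by
    intro i
    have hlt : Order.succ (max ℵ₀ #(Set.Iio (f i))) < κ :=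
      hsucc _ (max_lt hκ0 (mk_Iio_ord_lt _))
    obtain ⟨𝒵, h𝒵, hZc⟩ := Cardinal.le_mk_iff_exists_subset.1 (hlt.le.trans hcard.ge)
    obtain ⟨x, hx⟩ := hLL.famCompact_of_isRegular h𝒻 (isRegular_succ (le_max_left _ _))
      (Order.lt_succ_of_le (le_max_left _ _)) 𝒵 (h𝒵.trans h𝒴) hZc
    refine ⟨x, fun U hU => ?_⟩
    have h1 : #(Set.Iio (f i)) < #𝒵 := by
      rw [hZc]
      exact Order.lt_succ_of_le (le_max_right _ _)
    rw [← hx U hU] at h1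
    exact h1.trans_le (Cardinal.mk_le_mk_of_subset fun Y hY => ⟨h𝒵 hY.1, hY.2⟩)
  choose x hx using hx
  obtain ⟨z, hz⟩ := hLL.exists_forall_mk_eq x hreg hι
  obtain ⟨U, hU, hzU, hUκ⟩ := hO z
  obtain ⟨g, hg⟩ : ∃ g : κ.ord.ToType,
      #{Y | Y ∈ 𝒴 ∧ (Y ∩ U).Nonempty} ≤ #(Set.Iio g) := exists_le_mk_Iio hUκ
  refine (hf g).not_ge ((hz U (hU.mem_nhds hzU)).ge.trans (Cardinal.mk_le_mk_of_subset ?_))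
  intro i hi
  by_contra hlt
  have hlt : g < f i := not_le.1 hlt
  exact ((hx i U (hU.mem_nhds hi)).trans_le hg).not_ge
    (Cardinal.mk_le_mk_of_subset (Set.Iio_subset_Iio hlt.le))

lemma LinearlyLindelof.famCompact_of_cof_eq_aleph0 (hLL : LinearlyLindelof X) {𝒻 : Set (Set X)}
    (hω : FamCompact 𝒻 (ℵ_ Ordinal.omega0)) {κ : Cardinal.{u}} (hκ : κ.IsSingular)
    (hcof : κ.ord.cof = ℵ₀) : FamCompact 𝒻 κ := by
  intro 𝒴 h𝒴 hcard
  refine exists_isCapFamily_of_isOpen hcard fun hO => ?_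
  have hκ0 : ℵ₀ < κ := hcof ▸ hκ.cof_ord_lt
  obtain ⟨α, ι, f, hα, hreg, hι, hf⟩ := exists_sequences_of_cof_eq_aleph0 hκ hcof
  obtain ⟨W, ρ, hW, hρ⟩ := exists_rank_aleph_omega0.{u}
  have hcode : #(List α × W) ≤ #𝒴 := by
    rw [Cardinal.mk_prod, Cardinal.lift_id, Cardinal.lift_id, hcard]
    refine Cardinal.mul_le_of_le hκ0.le ((Cardinal.mk_list_le_max α).trans (max_le hκ0.le hα)) ?_
    rw [hW]
    exact hκ.aleph_omega0_le
  obtain ⟨c⟩ := hcode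
  let A : ι → W → Set X := fun i w => c ((List.range (ρ w)).map (f i), w)
  have hAinj : ∀ i, Function.Injective (A i) := fun i w w' h =>
    congrArg Prod.snd (c.injective (Subtype.ext h))
  have hA𝒴 : ∀ i, Set.range (A i) ⊆ 𝒴 := fun i => by
    rintro _ ⟨w, rfl⟩
    exact Subtype.coe_prop _
  have hAcard : ∀ i, #(Set.range (A i)) = ℵ_ Ordinal.omega0 := fun i => by
    rw [Cardinal.mk_range_eq _ (hAinj i), hW]
  choose x hx using fun i => hω _ ((hA𝒴 i).trans h𝒴) (hAcard i)
  obtain ⟨z, hz⟩ := hLL.exists_forall_mk_eq x hreg hι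
  obtain ⟨U, hU, hzU, hUκ⟩ := hO z
  let T : Set (List α × W) := {t | ((c t : Set X) ∩ U).Nonempty}
  have hT : #T < κ := lt_of_le_of_lt (Cardinal.mk_le_of_injective
    (f := fun t : T => (⟨c t, (c t).2, t.2⟩ : {Y | Y ∈ 𝒴 ∧ (Y ∩ U).Nonempty}))
    fun s t h => Subtype.ext (c.injective (Subtype.ext (Subtype.mk.inj h)))) hUκ
  let S : Set α := ⋃ t : T, {s | s ∈ t.1.1}
  have hS : #S < κ := by
    refine (Cardinal.mk_iUnion_le_sum_mk.trans (Cardinal.sum_le_sum _ (fun _ => ℵ₀) ?_)).trans_lt ?_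
    · intro t
      rw [Cardinal.le_aleph0_iff_set_countable]
      exact (List.finite_toSet t.1.1).countable
    · rw [Cardinal.sum_const']
      exact Cardinal.mul_lt_of_lt hκ0.le hT hκ0
  refine (hf S hS).not_ge ((hz U (hU.mem_nhds hzU)).ge.trans (Cardinal.mk_le_mk_of_subset ?_))
  intro i hi n
  by_contra hn
  have hsub : {Y | Y ∈ Set.range (A i) ∧ (Y ∩ U).Nonempty} ⊆ A i '' {w | ρ w < n + 1} := by
    rintro _ ⟨⟨w, rfl⟩, hw⟩
    refine ⟨w, ?_, rfl⟩
    by_contra hlt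
    refine hn (Set.mem_iUnion.2 ⟨⟨_, hw⟩, ?_⟩)
    simp only [Set.mem_ofPred_eq, List.mem_map, List.mem_range] at hlt ⊢
    exact ⟨n, by omega, rfl⟩
  have := (Cardinal.mk_le_mk_of_subset hsub).trans Cardinal.mk_image_le
  rw [hx i U (hU.mem_nhds hi), hAcard] at this
  exact (hρ (n + 1)).not_ge this

end LinearlyLindelof

/-- Corollary 2.3: if `X` is linearly Lindelöf and `𝒻`-`ℵ_ω`-compact, then `X`
is `𝒻`-`κ`-compact for every uncountable cardinal `κ`. -/
theorem linearlyLindelof_famCompact {X : Type u} [TopologicalSpace X]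
    (𝒻 : Set (Set X)) (h𝒻ne : 𝒻.Nonempty) (h𝒻 : ∅ ∉ 𝒻)
    (hLL : LinearlyLindelof X)
    (hω : FamCompact 𝒻 (Cardinal.aleph Ordinal.omega0)) :
    ∀ κ : Cardinal.{u}, ℵ₀ < κ → FamCompact 𝒻 κ := by
  intro κ hκ
  by_cases hreg : κ.IsRegular
  · exact hLL.famCompact_of_isRegular h𝒻 hreg hκ
  have hsing : κ.IsSingular := .of_not_isRegular hκ.le hreg
  have hcof : ℵ₀ ≤ κ.ord.cof := (isRegular_cof (Cardinal.isSuccLimit_ord hκ.le)).aleph0_le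
  rcases hcof.lt_or_eq with h | h
  · exact hLL.famCompact_of_aleph0_lt_cof h𝒻 hsing h
  · exact hLL.famCompact_of_cof_eq_aleph0 hω hsing h.symm
end

section
/- If Φ(μ, κ, λ) holds, D' ⊆ P(I') is μ-decomposable, and D ⊆ P(I) is λ-decomposable, then the product D × D' is κ-decomposable. -/
open Cardinal

universe u v w

/-- `D ⊆ P(I)` is `μ`-decomposable: there is `f : I → μ` with `f ⁻¹' Z ∉ D`
whenever `Z ⊆ μ` and `|Z| < μ`. -/
def Decomposable {I : Type w} (D : Set (Set I)) (μ : Cardinal.{v}) : Prop :=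
  ∃ f : I → μ.out, ∀ Z : Set μ.out, #Z < μ → f ⁻¹' Z ∉ D

/-- The product `D × D'` of two families of sets:
`X ∈ D × D'` iff `{i : {i' : (i, i') ∈ X} ∈ D'} ∈ D`. -/
def prodFam {I : Type w} {I' : Type v} (D : Set (Set I)) (D' : Set (Set I')) :
    Set (Set (I × I')) :=
  {X | {i : I | {i' : I' | (i, i') ∈ X} ∈ D'} ∈ D}

/-- Theorem 3.1 (Theorem `main`): if `Φ(μ, κ, λ)` holds, `D'` is
`μ`-decomposable and `D` is `λ`-decomposable, then `D × D'` is
`κ`-decomposable. -/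
theorem prod_decomposable {I : Type w} {I' : Type v}
    (μ κ lam : Cardinal.{u}) (hμ : ℵ₀ ≤ μ) (hκ : ℵ₀ ≤ κ) (hlam : ℵ₀ ≤ lam)
    (hPhi : JSPhi μ κ lam)
    (D : Set (Set I)) (D' : Set (Set I'))
    (hD' : Decomposable D' μ) (hD : Decomposable D lam) :
    Decomposable (prodFam D D') κ := by
  obtain ⟨S, hS, hA⟩ := hPhi
  obtain ⟨f, hf⟩ := hD
  obtain ⟨g, hg⟩ := hD'
  have he (ξ : lam.out) : Nonempty (μ.out ≃ S ξ) :=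
    Cardinal.eq.1 ((mk_out μ).trans (hS ξ).symm)
  let e (ξ : lam.out) : μ.out ≃ S ξ := (he ξ).some
  refine ⟨fun p => (e (f p.1) (g p.2)).1, fun Z hZ => ?_⟩
  refine hf {ξ | g ⁻¹' {x | (e ξ x).1 ∈ Z} ∈ D'} (lt_of_le_of_lt (mk_le_mk_of_subset ?_) (hA Z hZ))
  intro ξ hξ
  refine le_antisymm ((mk_le_mk_of_subset Set.inter_subset_right).trans_eq (hS ξ)) ?_
  by_contra! hlt
  refine hg _ (lt_of_le_of_lt ?_ hlt) hξ
  refine mk_le_of_injective (f := fun x : {x | (e ξ x).1 ∈ Z} =>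
    (⟨(e ξ x.1).1, x.2, (e ξ x.1).2⟩ : ↥(Z ∩ S ξ))) fun x y hxy => ?_
  exact Subtype.ext ((e ξ).injective (Subtype.ext (congrArg (fun z : ↥(Z ∩ S ξ) => z.1) hxy)))
end

section
/- If Φ(μ, κ, λ) holds, D' ⊆ P(μ) is uniform over μ, and D ⊆ P(λ) is uniform over λ, then the product D × D' is κ-decomposable. -/
open Cardinal

universe u v w

/-- The special case of Theorem 3.1: if `Φ(μ, κ, λ)` holds, `D' ⊆ P(μ)` is
uniform over `μ` and `D ⊆ P(λ)` is uniform over `λ`, then `D × D'` is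
`κ`-decomposable. -/
theorem prod_decomposable_of_uniform
    (μ κ lam : Cardinal.{u}) (hμ : ℵ₀ ≤ μ) (hκ : ℵ₀ ≤ κ) (hlam : ℵ₀ ≤ lam)
    (hPhi : JSPhi μ κ lam)
    (D : Set (Set lam.out)) (D' : Set (Set μ.out))
    (hD : ∀ A ∈ D, #A = lam) (hD' : ∀ A ∈ D', #A = μ) :
    Decomposable (prodFam D D') κ := by
  obtain ⟨S, hS, hA⟩ := hPhi
  have hequiv : ∀ ξ, Nonempty (μ.out ≃ S ξ) := fun ξ =>
    Cardinal.eq.1 (by rw [mk_out, hS])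
  let e : ∀ ξ, μ.out ≃ S ξ := fun ξ => (hequiv ξ).some
  refine ⟨fun p => e p.1 p.2, fun Z hZ hmem => (hA Z hZ).not_ge ?_⟩
  refine (hD _ hmem).ge.trans (mk_le_mk_of_subset fun ξ hξ => ?_)
  refine le_antisymm ((mk_le_mk_of_subset Set.inter_subset_right).trans (hS ξ).le) ?_
  refine (hD' _ hξ).ge.trans <| mk_le_of_injective
    (f := fun i => (⟨e ξ i.1, i.2, (e ξ i.1).2⟩ : ↥(Z ∩ S ξ)))
    fun i j hij => Subtype.ext ((e ξ).injective (Subtype.ext (Subtype.mk.inj hij)))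
end

section
/- If κ is a singular cardinal, D' ⊆ P(I') is cf(κ)-decomposable, and D ⊆ P(I) is κ⁺-decomposable, then the product D × D' is κ-decomposable. -/
open Cardinal

universe u v w

section WellOrder

variable {T : Type u} [LinearOrder T]

theorem exists_forall_mem_lt_of_mk_lt_cof {S : Set T} (hS : #S < Order.cof T) :
    ∃ b, ∀ s ∈ S, s < b :=
  not_isCofinal_iff.1 fun h => (Order.cof_le h).not_gt hS

theorem exists_forall_lt_of_mk_lt_cof_s7 {ι : Type u} (f : ι → T) (hι : #ι < Order.cof T) :
    ∃ b, ∀ i, f i < b := by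
  obtain ⟨b, hb⟩ := exists_forall_mem_lt_of_mk_lt_cof (mk_range_le.trans_lt hι : #(Set.range f) < _)
  exact ⟨b, fun i => hb _ ⟨i, rfl⟩⟩

theorem exists_gt_of_aleph0_le_cof (hT : ℵ₀ ≤ Order.cof T) (a : T) : ∃ b, a < b := by
  obtain ⟨b, hb⟩ := exists_forall_mem_lt_of_mk_lt_cof (S := {a})
    (by rw [mk_singleton]; exact one_lt_aleph0.trans_le hT)
  exact ⟨b, hb a rfl⟩

variable [WellFoundedLT T]

theorem exists_isLeast {S : Set T} (hS : S.Nonempty) : ∃ b, IsLeast S b :=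
  ⟨wellFounded_lt.min S hS, wellFounded_lt.min_mem S hS, fun _ h =>
    not_lt.1 (wellFounded_lt.not_lt_min S h)⟩

theorem exists_isLUB_of_bddAbove {S : Set T} (hS : BddAbove S) : ∃ b, IsLUB S b :=
  exists_isLeast hS

theorem exists_recursive_choice {A : T → Type v} (R : ∀ t, (∀ s : Set.Iio t, A s) → A t → Prop)
    (h : ∀ t g, ∃ a, R t g a) : ∃ d : ∀ t, A t, ∀ t, R t (fun s => d s) (d t) := by
  choose F hF using h
  refine ⟨wellFounded_lt.fix fun t ih => F t fun s => ih s.1 s.2, fun t => ?_⟩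
  conv => arg 3; rw [WellFounded.fix_eq]
  exact hF _ _

theorem isClub_setOf_forall_lt (hT : ℵ₀ < Order.cof T)
    (hI : ∀ t : T, #(Set.Iio t) < Order.cof T) (h : T → T) : IsClub {i | ∀ j < i, h j < i} := by
  refine ⟨fun d hd _ _ a ha j hj => ?_, fun a => ?_⟩
  · obtain ⟨e, he, hje⟩ := (lt_isLUB_iff ha).1 hj
    exact (hd he j hje).trans_le (ha.1 he)
  · have step : ∀ t : T, ∃ b, t < b ∧ ∀ j ≤ t, h j < b := by
      intro t
      obtain ⟨t', ht'⟩ := exists_gt_of_aleph0_le_cof hT.le t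
      obtain ⟨b, hb⟩ := exists_forall_lt_of_mk_lt_cof_s7 (fun j : Set.Iio t' => h j) (hI t')
      exact ⟨max t' b, lt_max_of_lt_left ht',
        fun j hj => lt_max_of_lt_right (hb ⟨j, hj.trans_lt ht'⟩)⟩
    choose g hg hgh using step
    have hbdd : BddAbove (Set.range fun n : ULift.{u} ℕ => g^[n.down] a) := by
      obtain ⟨b, hb⟩ := exists_forall_lt_of_mk_lt_cof_s7 (fun n : ULift.{u} ℕ => g^[n.down] a)
        (by simpa using hT)
      exact ⟨b, by rintro _ ⟨n, rfl⟩; exact (hb n).le⟩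
    obtain ⟨b, hb⟩ := exists_isLUB_of_bddAbove hbdd
    refine ⟨b, fun j hj => ?_, hb.1 ⟨⟨0⟩, rfl⟩⟩
    obtain ⟨_, ⟨n, rfl⟩, hn⟩ := (lt_isLUB_iff hb).1 hj
    refine (hgh _ j hn.le).trans_le (hb.1 ⟨⟨n.down + 1⟩, ?_⟩)
    simp [Function.iterate_succ_apply']

theorem cof_ord_toType {c : Cardinal.{u}} (hc : c.IsRegular) : Order.cof c.ord.ToType = c := by
  rw [Ordinal.cof_toType, hc.cof_ord]

theorem mk_Iio_ord_toType_lt {c : Cardinal.{u}} (i : c.ord.ToType) : #(Set.Iio i) < c := by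
  simpa using mk_Iio_lt i

/-- Club guessing: a well-order of cofinality above `σ⁺`, `σ` regular, carries a sequence of sets
such that every club contains a member of the sequence of size at least `σ`. -/
theorem exists_club_guessing {σ : Cardinal.{u}} (hσ : σ.IsRegular)
    (hT : Order.succ σ < Order.cof T) :
    ∃ C : T → Set T, ∀ D, IsClub D → ∃ t, σ ≤ #(C t) ∧ C t ⊆ D := by
  have hσT : σ < Order.cof T := (Order.le_succ σ).trans_lt hT
  have hne : Order.cof T ≠ ℵ₀ := (hσ.aleph0_le.trans_lt hσT).ne'
  have hc : ∀ t : T, ∃ c : Set T,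
      (∃ S : Set T, S ⊆ Set.Iio t ∧ (∀ b < t, ∃ g ∈ S, b ≤ g) ∧ #S ≤ σ) →
      (c ⊆ Set.Iio t ∧ (∀ b < t, ∃ g ∈ c, b ≤ g) ∧ #c ≤ σ) := by
    intro t
    by_cases h : ∃ S : Set T, S ⊆ Set.Iio t ∧ (∀ b < t, ∃ g ∈ S, b ≤ g) ∧ #S ≤ σ
    · exact ⟨h.choose, fun _ => h.choose_spec⟩
    · exact ⟨∅, fun h' => absurd h' h⟩
  choose c hc using hc
  let G : Set T → T → Set T := fun E t => {s | ∃ β ∈ c t, IsGreatest (E ∩ Set.Iic β) s}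
  by_contra! hcon
  choose next hclub hnext using fun E => hcon (G E)
  let W := (Order.succ σ).ord.ToType
  have hreg : (Order.succ σ).IsRegular := isRegular_succ hσ.aleph0_le
  have hW : #W = Order.succ σ := mk_ord_toType _
  obtain ⟨E, hE⟩ := exists_recursive_choice (T := W) (A := fun _ => Set T)
    (fun w g a => a = ⋂ v : Set.Iio w, next (g v)) fun w g => ⟨_, rfl⟩
  have hE_club : ∀ w, IsClub (E w) := by
    intro w
    rw [hE w]
    exact .iInter hne (by simpa using (mk_Iio_ord_toType_lt w).trans hT) fun _ => hclub _
  have hE_next : ∀ v w, v < w → E w ⊆ next (E v) := by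
    intro v w hvw
    rw [hE w]
    exact Set.iInter_subset _ (⟨v, hvw⟩ : Set.Iio w)
  have hE_anti : ∀ v w, v < w → E w ⊆ E v := by
    intro v w hvw
    rw [hE v]
    exact Set.subset_iInter fun x => hE_next _ _ (x.2.trans hvw)
  have hH : IsClub (⋂ w, E w) := .iInter hne (by simpa [hW] using hT) hE_club
  let S := σ.ord.ToType
  have hS : #S = σ := mk_ord_toType _
  obtain ⟨d, hd⟩ := exists_recursive_choice (T := S) (A := fun _ => T)
    (fun s g a => a ∈ ⋂ w, E w ∧ ∀ r, g r < a) fun s g => by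
      obtain ⟨b, hb⟩ := exists_forall_lt_of_mk_lt_cof_s7 g ((mk_Iio_ord_toType_lt s).trans hσT)
      obtain ⟨a, ha, hba⟩ := hH.isCofinal b
      exact ⟨a, ha, fun r => (hb r).trans_le hba⟩
  have hd_mem : ∀ s, d s ∈ ⋂ w, E w := fun s => (hd s).1
  have hd_lt : ∀ r s, r < s → d r < d s := fun r s hrs => (hd s).2 ⟨r, hrs⟩
  have hcofS : Order.cof S = σ := cof_ord_toType hσ
  obtain ⟨δ, hδ⟩ : ∃ δ, IsLUB (Set.range d) δ := by
    obtain ⟨b, hb⟩ := exists_forall_lt_of_mk_lt_cof_s7 d (hS.trans_lt hσT)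
    exact exists_isLUB_of_bddAbove ⟨b, by rintro _ ⟨s, rfl⟩; exact (hb s).le⟩
  have hdδ : ∀ s, d s < δ := by
    intro s
    obtain ⟨r, hr⟩ := exists_gt_of_aleph0_le_cof (hσ.aleph0_le.trans hcofS.ge) s
    exact (hd_lt _ _ hr).trans_le (hδ.1 ⟨r, rfl⟩)
  obtain ⟨hc_sub, hc_cof, hc_card⟩ := hc δ ⟨Set.range d, by rintro _ ⟨s, rfl⟩; exact hdδ s,
    fun b hb => (by
      obtain ⟨g, hg, hbg⟩ := (lt_isLUB_iff hδ).1 hb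
      exact ⟨g, hg, hbg.le⟩), mk_range_le.trans hS.le⟩
  have hG : ∀ w, σ ≤ #(G (E w) δ) := by
    intro w
    by_contra! hlt
    have : ∀ s : G (E w) δ, ∃ r, s.1 < d r := by
      rintro ⟨s, β, hβ, hs⟩
      obtain ⟨_, ⟨r, rfl⟩, hr⟩ := (lt_isLUB_iff hδ).1 (hs.1.2.trans_lt (hc_sub hβ))
      exact ⟨r, hr⟩
    choose r hr using this
    obtain ⟨r', hr'⟩ := exists_forall_lt_of_mk_lt_cof_s7 r (hlt.trans_eq hcofS.symm)
    obtain ⟨β, hβ, hβ'⟩ := hc_cof _ (hdδ r')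
    have hmem : d r' ∈ E w ∩ Set.Iic β := ⟨Set.mem_iInter.1 (hd_mem r') w, hβ'⟩
    obtain ⟨s, hs⟩ := exists_isLUB_of_bddAbove (S := E w ∩ Set.Iic β) ⟨β, fun _ h => h.2⟩
    have hsG : s ∈ G (E w) δ := ⟨β, hβ, ⟨(hE_club w).isLUB_mem Set.inter_subset_left ⟨_, hmem⟩ hs,
      hs.2 fun _ h => h.2⟩, hs.1⟩
    exact ((hr ⟨s, hsG⟩).trans (hd_lt _ _ (hr' _))).not_ge (hs.1 hmem)
  have hfail : ∀ w, ∃ β : c δ, ∃ s, IsGreatest (E w ∩ Set.Iic β.1) s ∧ s ∉ next (E w) := by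
    intro w
    obtain ⟨s, ⟨β, hβ, hs⟩, hs'⟩ := Set.not_subset.1 (hnext _ δ (hG w))
    exact ⟨⟨β, hβ⟩, s, hs, hs'⟩
  choose β s hs hs_next using hfail
  obtain ⟨b, hb⟩ := infinite_pigeonhole_card β (Order.succ σ) hW.ge hreg.aleph0_le
    (by rw [hreg.cof_ord]; exact Order.lt_succ_of_le hc_card)
  have hunb : ∀ w : W, ∃ v ∈ β ⁻¹' {b}, w < v := by
    intro w
    by_contra! hle
    obtain ⟨w', hw'⟩ := exists_gt_of_aleph0_le_cof
      (by rw [cof_ord_toType hreg]; exact hreg.aleph0_le) w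
    exact (hb.trans (mk_le_mk_of_subset fun v hv => (hle v hv).trans_lt hw')).not_gt
      (mk_Iio_ord_toType_lt w')
  have hne' : (s '' (β ⁻¹' {b})).Nonempty := by
    rw [Set.image_nonempty, ← Set.nonempty_coe_sort, ← mk_ne_zero_iff]
    exact (hreg.pos.trans_le hb).ne'
  obtain ⟨_, ⟨v, hv, rfl⟩, hmin⟩ := exists_isLeast hne'
  obtain ⟨w, hw, hvw⟩ := hunb v
  have hβ : β w = β v := by rw [hw, hv]
  have hle : s w ≤ s v := (hs v).2 ⟨hE_anti _ _ hvw (hs w).1.1, hβ ▸ (hs w).1.2⟩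
  have heq : s w = s v := hle.antisymm (hmin ⟨w, hw, rfl⟩)
  exact hs_next v (heq ▸ hE_next _ _ hvw (hs w).1.1)

end WellOrder

section Scale

variable {K L : Type u} [LinearOrder K] [WellFoundedLT K] [LinearOrder L]
  {V : L → Type u} [∀ x, LinearOrder (V x)]

/-- If every `f δ` eventually dominates, uniformly, the members of the family indexed by the limit
points below `δ` of some cofinal subset of `Iio δ`, then every cofinal set of indices contains many
indices along which `f` is eventually injective, with a uniform threshold. -/
theorem exists_uniformly_injective_subfamily {κ σ : Cardinal.{u}} (hK : κ < Order.cof K)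
    (hσ : σ.IsRegular) (hL : #L < σ) (hσκ : Order.succ (Order.succ σ) ≤ κ)
    (f : K → ∀ x, V x)
    (hf : ∀ α, ∀ β < α, ∃ x₀, ∀ x ≥ x₀, f β x < f α x)
    (hE : ∀ δ, (∃ G ⊆ Set.Iio δ, (∀ b < δ, ∃ g ∈ G, b < g) ∧ #G ≤ Order.succ (Order.succ σ)) →
      ∃ G ⊆ Set.Iio δ, (∀ b < δ, ∃ g ∈ G, b < g) ∧
        ∃ x₀, ∀ x ≥ x₀, ∀ β < δ, (∀ b < β, ∃ g ∈ G, b < g ∧ g < β) → f β x < f δ x)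
    (X : Set K) (hX : ∀ a, ∃ b ∈ X, a < b) :
    ∃ (ι : Type u) (y : ι → K), σ ≤ #ι ∧ (∀ i, y i ∈ X) ∧
      ∃ x₀, ∀ x ≥ x₀, Function.Injective fun i => f (y i) x := by
  set τ := Order.succ (Order.succ σ) with hτ
  have hστ : Order.succ σ < τ := Order.lt_succ _
  have hτreg : τ.IsRegular := isRegular_succ (hσ.aleph0_le.trans (Order.le_succ _))
  let T := τ.ord.ToType
  have hT : #T = τ := mk_ord_toType _
  have hcofT : Order.cof T = τ := cof_ord_toType hτreg
  have hτK : τ < Order.cof K := hσκ.trans_lt hK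
  obtain ⟨C, hC⟩ := exists_club_guessing (T := T) hσ (hστ.trans_eq hcofT.symm)
  let P : Set K → K → Prop := fun S η => ∃ x₀, ∀ x ≥ x₀, ∀ β ∈ S, f β x ≤ f η x
  let Q : K → (T → Set K) → K → Prop := fun a S b => a < b ∧ ∃ y ∈ X, a < y ∧ y < b ∧
    ∀ t, (∃ η, P (S t) η) → ∃ η < y, P (S t) η
  have hQ_mono : ∀ {a S b b'}, Q a S b → b ≤ b' → Q a S b' := by
    rintro a S b b' ⟨hab, y, hy, hay, hyb, h⟩ hb
    exact ⟨hab.trans_le hb, y, hy, hay, hyb.trans_le hb, h⟩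
  have hQ_ex : ∀ a S, ∃ b, Q a S b := by
    intro a S
    have : ∀ t, ∃ η, (∃ η, P (S t) η) → P (S t) η := by
      intro t
      by_cases h : ∃ η, P (S t) η
      · exact ⟨h.choose, fun _ => h.choose_spec⟩
      · exact ⟨a, fun h' => absurd h' h⟩
    choose η hη using this
    obtain ⟨b, hb⟩ := exists_forall_lt_of_mk_lt_cof_s7 η (hT.trans_lt hτK)
    obtain ⟨y, hyX, hy⟩ := hX (max a b)
    obtain ⟨z, -, hz⟩ := hX y
    rw [max_lt_iff] at hy
    exact ⟨z, hy.1.trans hz, y, hyX, hy.1, hz, fun t ht => ⟨η t, (hb t).trans hy.2, hη t ht⟩⟩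
  obtain ⟨ξ, hξ⟩ := exists_recursive_choice (T := T) (A := fun _ => K)
    (fun i g a => IsLeast
      {b | ∀ j : Set.Iio i, Q (g j) (fun t => g '' {m | m.1 ∈ C t ∧ m.1 ≤ j.1}) b} a) fun i g => by
      choose b hb using fun j : Set.Iio i => hQ_ex (g j) fun t => g '' {m | m.1 ∈ C t ∧ m.1 ≤ j.1}
      obtain ⟨b', hb'⟩ := exists_forall_lt_of_mk_lt_cof_s7 b ((mk_Iio_ord_toType_lt i).trans hτK)
      exact exists_isLeast ⟨b', fun j => hQ_mono (hb j) (hb' j).le⟩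
  have hξ_im : ∀ (i : T) (j : Set.Iio i) (t : T),
      (fun m : Set.Iio i => ξ m) '' {m | m.1 ∈ C t ∧ m.1 ≤ j.1} =
        ξ '' {m | m ∈ C t ∧ m ≤ j} := by
    intro i j t
    ext a
    constructor
    · rintro ⟨m, hm, rfl⟩
      exact ⟨m, hm, rfl⟩
    · rintro ⟨m, hm, rfl⟩
      exact ⟨⟨m, hm.2.trans_lt j.2⟩, hm, rfl⟩
  have hξQ : ∀ j i, j < i → Q (ξ j) (fun t => ξ '' {m | m ∈ C t ∧ m ≤ j}) (ξ i) := by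
    intro j i hji
    have h : Q (ξ j) (fun t => (fun m : Set.Iio i => ξ m) '' {m | m.1 ∈ C t ∧ m.1 ≤ j}) (ξ i) :=
      (hξ i).1 ⟨j, hji⟩
    rwa [funext (hξ_im i ⟨j, hji⟩)] at h
  have hξ_lt : ∀ j i, j < i → ξ j < ξ i := fun j i hji => (hξQ j i hji).1
  have hξ_cont : ∀ i b, b < ξ i → ∃ j < i, ∀ j', j < j' → j' < i → b < ξ j' := by
    intro i b hb
    by_contra! hcon
    refine hb.not_ge ((hξ i).2 fun j => ?_)
    obtain ⟨j', hj, -, hle⟩ := hcon j j.2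
    simp only [hξ_im]
    exact hQ_mono (hξQ j j' hj) hle
  have hTsucc : ∀ i : T, ∃ j, i < j :=
    exists_gt_of_aleph0_le_cof (hτreg.aleph0_le.trans hcofT.ge)
  obtain ⟨δ, hδ⟩ : ∃ δ, IsLUB (Set.range ξ) δ := by
    obtain ⟨b, hb⟩ := exists_forall_lt_of_mk_lt_cof_s7 ξ (hT.trans_lt hτK)
    exact exists_isLUB_of_bddAbove ⟨b, by rintro _ ⟨s, rfl⟩; exact (hb s).le⟩
  have hξδ : ∀ i, ξ i < δ := by
    intro i
    obtain ⟨j, hj⟩ := hTsucc i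
    exact (hξ_lt _ _ hj).trans_le (hδ.1 ⟨j, rfl⟩)
  have hδξ : ∀ b < δ, ∃ i, b < ξ i := by
    intro b hb
    obtain ⟨_, ⟨i, rfl⟩, hi⟩ := (lt_isLUB_iff hδ).1 hb
    exact ⟨i, hi⟩
  obtain ⟨G, hG, hGcof, xδ, hxδ⟩ := hE δ ⟨Set.range ξ, by rintro _ ⟨s, rfl⟩; exact hξδ s,
    fun b hb => (hδξ b hb).elim fun i hi => ⟨_, ⟨i, rfl⟩, hi⟩, mk_range_le.trans hT.le⟩
  have hh : ∀ j, ∃ m, ∃ g ∈ G, ξ j < g ∧ g < ξ m := by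
    intro j
    obtain ⟨g, hg, hjg⟩ := hGcof _ (hξδ j)
    obtain ⟨m, hm⟩ := hδξ g (hG hg)
    exact ⟨m, g, hg, hjg, hm⟩
  choose h hh using hh
  have hjh : ∀ j, j < h j := by
    intro j
    obtain ⟨g, -, h1, h2⟩ := hh j
    by_contra! hle
    rcases hle.eq_or_lt with heq | hlt
    · exact (heq ▸ h1.trans h2).false
    · exact ((hξ_lt _ _ hlt).trans (h1.trans h2)).false
  obtain ⟨t, hσt, hCt⟩ := hC _ (isClub_setOf_forall_lt
    ((hσ.aleph0_le.trans_lt ((Order.lt_succ σ).trans hστ)).trans_eq hcofT.symm)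
    (fun i => (mk_Iio_ord_toType_lt i).trans_eq hcofT.symm) h)
  have hlim : ∀ i ∈ C t, ∀ b < ξ i, ∃ g ∈ G, b < g ∧ g < ξ i := by
    intro i hi b hb
    obtain ⟨j, hj, hjb⟩ := hξ_cont i b hb
    have h1 : h j < i := hCt hi j hj
    obtain ⟨g, hg, hjg, hgm⟩ := hh (h j)
    exact ⟨g, hg, (hjb _ (hjh j) h1).trans hjg, hgm.trans (hξ_lt _ _ (hCt hi _ h1))⟩
  have hPδ : ∀ i, P (ξ '' {m | m ∈ C t ∧ m ≤ i}) δ := by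
    intro i
    refine ⟨xδ, fun x hx => ?_⟩
    rintro _ ⟨m, hm, rfl⟩
    exact (hxδ x hx _ (hξδ m) (hlim m hm.1)).le
  have hstep : ∀ i : C t, ∃ y ∈ X, ∃ x₀, ∀ x ≥ x₀, (∀ m ∈ C t, m ≤ i.1 → f (ξ m) x < f y x) ∧
      ∀ i' ∈ C t, i.1 < i' → ∃ m ∈ C t, m ≤ i' ∧ f y x < f (ξ m) x := by
    intro i
    obtain ⟨s, his, hs⟩ : ∃ s, i.1 < s ∧ ∀ i' ∈ C t, i.1 < i' → s ∈ C t ∧ s ≤ i' := by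
      by_cases hmax : {i' | i' ∈ C t ∧ i.1 < i'}.Nonempty
      · obtain ⟨s, hs⟩ := exists_isLeast hmax
        exact ⟨s, hs.1.2, fun i' h1 h2 => ⟨hs.1.1, hs.2 ⟨h1, h2⟩⟩⟩
      · obtain ⟨s, hs⟩ := hTsucc i
        exact ⟨s, hs, fun i' h1 h2 => absurd ⟨i', h1, h2⟩ hmax⟩
    obtain ⟨-, y, hy, -, hys, hP⟩ := hξQ i s his
    obtain ⟨η, hηy, x₁, hx₁⟩ := hP t ⟨δ, hPδ i⟩
    obtain ⟨x₂, hx₂⟩ := hf y η hηy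
    obtain ⟨x₃, hx₃⟩ := hf (ξ s) y hys
    refine ⟨y, hy, max x₁ (max x₂ x₃), fun x hx => ?_⟩
    simp only [ge_iff_le, max_le_iff] at hx
    refine ⟨fun m hm hmi => (hx₁ x hx.1 _ ⟨m, ⟨hm, hmi⟩, rfl⟩).trans_lt (hx₂ x hx.2.1), ?_⟩
    intro i' hi' hii'
    exact ⟨s, (hs i' hi' hii').1, (hs i' hi' hii').2, hx₃ x hx.2.2⟩
  choose y hyX x₀ hy using hstep
  obtain ⟨a, ha⟩ := infinite_pigeonhole_card x₀ σ hσt hσ.aleph0_le (by rwa [hσ.cof_ord])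
  refine ⟨x₀ ⁻¹' {a}, fun i => y i, ha, fun i => hyX i, a, fun x hx => ?_⟩
  refine StrictMono.injective fun i i' hii' => ?_
  obtain ⟨m, hm, hmi, hlt⟩ := (hy i x (by rw [i.2]; exact hx)).2 i' i'.1.2 hii'
  exact hlt.trans ((hy i' x (by rw [i'.2]; exact hx)).1 m hm hmi)

end Scale

section Construction

variable {K L : Type u} [LinearOrder K] [WellFoundedLT K] [LinearOrder L]

theorem mk_limit_points_le {G : Set K} {δ : K} (hG : ∀ b < δ, ∃ g ∈ G, b < g) :
    #{β | β < δ ∧ ∀ b < β, ∃ g ∈ G, b < g ∧ g < β} ≤ #G := by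
  have hleast : ∀ β : {β | β < δ ∧ ∀ b < β, ∃ g ∈ G, b < g ∧ g < β},
      ∃ g, IsLeast {g | g ∈ G ∧ β ≤ g} g := fun β =>
    let ⟨g, hg, hβg⟩ := hG β β.2.1
    exists_isLeast ⟨g, hg, hβg.le⟩
  choose h hh using hleast
  refine mk_le_of_injective (f := fun β => (⟨h β, (hh β).1.1⟩ : G)) ?_
  have hlt : ∀ β β', β < β' → h β ≠ h β' := by
    intro β β' hlt
    obtain ⟨g, hg, hβg, hgβ⟩ := β'.2.2 β hlt
    exact ((((hh β).2 ⟨hg, hβg.le⟩).trans_lt hgβ).trans_le (hh β').1.2).ne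
  intro β β' heq
  have heq' : h β = h β' := congrArg Subtype.val heq
  by_contra hne
  rcases lt_or_gt_of_ne hne with hl | hl
  · exact hlt _ _ hl heq'
  · exact hlt _ _ hl heq'.symm

variable {V : L → Type u} [∀ x, LinearOrder (V x)]

/-- A family of functions that increases modulo eventual domination and is continuous along
each club whose limit points below its supremum are fewer than `κ`. -/
theorem exists_scale {κ : Cardinal.{u}} (hVκ : ∀ μ < κ, ∃ x₀, ∀ x ≥ x₀, μ < Order.cof (V x))
    (hV : ∀ x, ℵ₀ ≤ Order.cof (V x)) (A : K → L → Set K)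
    (hAV : ∀ α x, #(A α x) < Order.cof (V x))
    (hA : ∀ α, ∀ β < α, ∃ x₀, ∀ x ≥ x₀, β ∈ A α x) :
    ∃ f : K → ∀ x, V x, (∀ α, ∀ β < α, ∃ x₀, ∀ x ≥ x₀, f β x < f α x) ∧
      ∀ δ, (∃ G ⊆ Set.Iio δ, (∀ b < δ, ∃ g ∈ G, b < g) ∧ #G < κ) →
        ∃ G ⊆ Set.Iio δ, (∀ b < δ, ∃ g ∈ G, b < g) ∧ ∃ x₀, ∀ x ≥ x₀, ∀ β < δ,
          (∀ b < β, ∃ g ∈ G, b < g ∧ g < β) → f β x < f δ x := by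
  have hE : ∀ α : K, ∃ E : Set K,
      (∃ G ⊆ Set.Iio α, (∀ b < α, ∃ g ∈ G, b < g) ∧ #G < κ) → #E < κ ∧
        ∃ G ⊆ Set.Iio α, (∀ b < α, ∃ g ∈ G, b < g) ∧
          ∀ β < α, (∀ b < β, ∃ g ∈ G, b < g ∧ g < β) → β ∈ E := by
    intro α
    by_cases h : ∃ G ⊆ Set.Iio α, (∀ b < α, ∃ g ∈ G, b < g) ∧ #G < κ
    · obtain ⟨G, hGα, hG, hGκ⟩ := h
      exact ⟨_, fun _ => ⟨(mk_limit_points_le hG).trans_lt hGκ, G, hGα, hG,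
        fun β h1 h2 => ⟨h1, h2⟩⟩⟩
    · exact ⟨∅, fun h' => absurd h' h⟩
  choose E hE using hE
  obtain ⟨f, hf⟩ := exists_recursive_choice (T := K) (A := fun _ => ∀ x, V x)
    (fun α g a => ∀ x, ∀ β : Set.Iio α,
      (β.1 ∈ A α x ∨ β.1 ∈ E α ∧ #(E α) < Order.cof (V x)) → g β x < a x) (by
    intro α g
    have hx : ∀ x, ∃ v : V x, ∀ β : Set.Iio α,
        (β.1 ∈ A α x ∨ β.1 ∈ E α ∧ #(E α) < Order.cof (V x)) → g β x < v := by
      intro x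
      let S : Set K := {β | β ∈ A α x ∨ β ∈ E α ∧ #(E α) < Order.cof (V x)}
      have hS : #S < Order.cof (V x) := by
        by_cases h : #(E α) < Order.cof (V x)
        · refine (mk_le_mk_of_subset ?_).trans_lt
            ((mk_union_le (A α x) (E α)).trans_lt (add_lt_of_lt (hV x) (hAV α x) h))
          rintro β (hβ | hβ)
          exacts [Or.inl hβ, Or.inr hβ.1]
        · refine (mk_le_mk_of_subset ?_).trans_lt (hAV α x)
          rintro β (hβ | hβ)
          exacts [hβ, absurd hβ.2 h]
      obtain ⟨v, hv⟩ := exists_forall_lt_of_mk_lt_cof_s7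
        (fun β : (Subtype.val ⁻¹' S : Set (Set.Iio α)) => g β x)
        ((mk_preimage_of_injective _ S Subtype.val_injective).trans_lt hS)
      exact ⟨v, fun β hβ => hv ⟨β, hβ⟩⟩
    choose v hv using hx
    exact ⟨v, hv⟩)
  refine ⟨f, fun α β hβ => ?_, fun δ hδ => ?_⟩
  · obtain ⟨x₀, hx₀⟩ := hA α β hβ
    exact ⟨x₀, fun x hx => hf α x ⟨β, hβ⟩ (Or.inl (hx₀ x hx))⟩
  · obtain ⟨hEκ, G, hGδ, hG, hGE⟩ := hE δ hδ
    obtain ⟨x₀, hx₀⟩ := hVκ _ hEκ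
    exact ⟨G, hGδ, hG, x₀, fun x hx β hβ h =>
      hf δ x ⟨β, hβ⟩ (Or.inr ⟨hGE β hβ h, hx₀ x hx⟩)⟩

/-- A set of fewer than `κ` points meets the graph of `f α` in fewer than `#L` points, for all `α`
above some bound. -/
theorem exists_forall_mk_setOf_mem_lt {κ : Cardinal.{u}}
    (hκ : ∀ μ < κ, Order.succ μ < κ) (hK : κ < Order.cof K)
    (hL₀ : ℵ₀ ≤ #L) (hLκ : #L < κ) (hLI : ∀ x : L, #(Set.Iic x) < #L)
    (f : K → ∀ x, V x) (hf : ∀ α, ∀ β < α, ∃ x₀, ∀ x ≥ x₀, f β x < f α x)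
    (hE : ∀ δ, (∃ G ⊆ Set.Iio δ, (∀ b < δ, ∃ g ∈ G, b < g) ∧ #G < κ) →
      ∃ G ⊆ Set.Iio δ, (∀ b < δ, ∃ g ∈ G, b < g) ∧ ∃ x₀, ∀ x ≥ x₀, ∀ β < δ,
        (∀ b < β, ∃ g ∈ G, b < g ∧ g < β) → f β x < f δ x)
    (Z : Set (Σ x, V x)) (hZ : #Z < κ) :
    ∃ b, ∀ α, #L ≤ #{x | (⟨x, f α x⟩ : Σ x, V x) ∈ Z} → α ≤ b := by
  by_contra! hX
  have hσκ : Order.succ (max #Z #L) < κ := hκ _ (max_lt hZ hLκ)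
  have hσ : (Order.succ (max #Z #L)).IsRegular := isRegular_succ (le_max_of_le_right hL₀)
  obtain ⟨ι, y, hι, hyX, x₀, hx₀⟩ := exists_uniformly_injective_subfamily hK hσ
    (Order.lt_succ_of_le (le_max_right _ _)) (hκ _ (hκ _ hσκ)).le f hf
    (fun δ ⟨G, h1, h2, h3⟩ => hE δ ⟨G, h1, h2, h3.trans_lt (hκ _ (hκ _ hσκ))⟩)
    {α | #L ≤ #{x | (⟨x, f α x⟩ : Σ x, V x) ∈ Z}} (fun a => hX a)
  have hpt : ∀ i, ∃ x ≥ x₀, (⟨x, f (y i) x⟩ : Σ x, V x) ∈ Z := by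
    intro i
    by_contra! h
    refine ((hyX i).trans (mk_le_mk_of_subset (t := Set.Iic x₀) fun x hx => ?_)).not_gt (hLI x₀)
    by_contra hx'
    exact h x (not_le.1 hx').le hx
  choose x hx hxZ using hpt
  refine ((Order.lt_succ_of_le (le_max_left #Z #L)).trans_le hι).not_ge
    (mk_le_of_injective (f := fun i => (⟨_, hxZ i⟩ : Z)) fun i j hij => ?_)
  have h1 : (⟨x i, f (y i) (x i)⟩ : Σ x, V x) = ⟨x j, f (y j) (x j)⟩ := congrArg Subtype.val hij
  refine hx₀ (x i) (hx i) ?_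
  rw [Sigma.mk.injEq] at h1
  obtain ⟨h1, h2⟩ := h1
  show f (y i) (x i) = f (y j) (x i)
  rw [← h1] at h2
  exact eq_of_heq h2

end Construction

section Singular

theorem exists_mk_Iio_eq {c μ : Cardinal.{u}} (hμ : μ < c) :
    ∃ y : c.ord.ToType, #(Set.Iio y) = μ := by
  refine ⟨Ordinal.ToType.mk ⟨μ.ord, ord_lt_ord.2 hμ⟩, ?_⟩
  exact (Ordinal.card_typein (r := (· < ·)) _).symm.trans
    ((congrArg Ordinal.card (Ordinal.typein_enum _ _)).trans (card_ord μ))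

theorem exists_eventually_lt {Y L : Type u} [LinearOrder Y] [LinearOrder L]
    (hL : #L = Order.cof Y) (hLI : ∀ x : L, #(Set.Iic x) < #L) :
    ∃ k : L → Y, ∀ y, ∃ x₀, ∀ x ≥ x₀, y < k x := by
  obtain ⟨S, hS, hSc⟩ := Order.exists_cof_eq (α := Y)
  obtain ⟨e⟩ := Cardinal.eq.1 (hL.trans hSc.symm)
  choose k hk using fun x =>
    exists_forall_lt_of_mk_lt_cof_s7 (fun x' : Set.Iic x => (e x' : Y)) ((hLI x).trans_eq hL)
  refine ⟨k, fun y => ?_⟩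
  obtain ⟨s, hs, hys⟩ := hS y
  refine ⟨e.symm ⟨s, hs⟩, fun x hx => hys.trans_lt ?_⟩
  simpa using hk x ⟨_, hx⟩

theorem succ_lt_of_cof_ord_lt {κ μ : Cardinal.{u}} (hκ : ℵ₀ ≤ κ) (hsing : κ.ord.cof < κ)
    (hμ : μ < κ) : Order.succ μ < κ := by
  refine (Order.succ_le_of_lt hμ).lt_of_ne fun h => ?_
  rcases le_or_gt ℵ₀ μ with h' | h'
  · have := (isRegular_succ h').cof_ord
    rw [h] at this
    exact hsing.ne this
  · have := isSuccLimit_aleph0.succ_lt h'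
    exact (h ▸ this).not_ge hκ

theorem mk_Iic_ord_toType_lt {c : Cardinal.{u}} (hc : ℵ₀ ≤ c) (i : c.ord.ToType) :
    #(Set.Iic i) < c := by
  simpa using mk_Iic_lt i (by simp) (by simpa using hc)

theorem exists_function_of_singular {κ : Cardinal.{u}} (hκ : ℵ₀ ≤ κ) (hsing : κ.ord.cof < κ) :
    ∃ g : (Order.succ κ).ord.ToType → κ.ord.cof.ord.ToType → κ.ord.ToType,
      ∀ Z : Set κ.ord.ToType, #Z < κ → #{a | κ.ord.cof ≤ #{x | g a x ∈ Z}} ≤ κ := by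
  have hlim : ∀ μ < κ, Order.succ μ < κ := fun μ => succ_lt_of_cof_ord_lt hκ hsing
  have hcof : ℵ₀ ≤ κ.ord.cof := (isRegular_cof (isSuccLimit_ord hκ)).aleph0_le
  have hL : #κ.ord.cof.ord.ToType = κ.ord.cof := mk_ord_toType _
  have hLI : ∀ x : κ.ord.cof.ord.ToType, #(Set.Iic x) < #κ.ord.cof.ord.ToType :=
    fun x => (mk_Iic_ord_toType_lt hcof x).trans_eq hL.symm
  have hκ₀ : ℵ₀ < κ := hcof.trans_lt hsing
  obtain ⟨k, hk⟩ := exists_eventually_lt (Y := κ.ord.ToType)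
    (hL.trans (Ordinal.cof_toType _).symm) hLI
  let θ : κ.ord.cof.ord.ToType → Cardinal.{u} := fun x => Order.succ (max #(Set.Iio (k x)) ℵ₀)
  have hθ : ∀ x, (θ x).IsRegular := fun x => isRegular_succ (le_max_right _ _)
  have hθκ : ∀ x, θ x < κ := fun x => hlim _ (max_lt (mk_Iio_ord_toType_lt _) hκ₀)
  have hVθ : ∀ x, Order.cof (θ x).ord.ToType = θ x := fun x => cof_ord_toType (hθ x)
  have hθlarge : ∀ μ < κ, ∃ x₀, ∀ x ≥ x₀, μ < Order.cof (θ x).ord.ToType := by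
    intro μ hμ
    obtain ⟨y, rfl⟩ := exists_mk_Iio_eq hμ
    obtain ⟨x₀, hx₀⟩ := hk y
    exact ⟨x₀, fun x hx => (Order.lt_succ_of_le (le_max_of_le_left
      (mk_le_mk_of_subset (Set.Iio_subset_Iio (hx₀ x hx).le)))).trans_eq (hVθ x).symm⟩
  have he : ∀ α : (Order.succ κ).ord.ToType, Nonempty (Set.Iio α ↪ κ.ord.ToType) := fun α =>
    Cardinal.le_def _ _ |>.1 <| (Order.lt_succ_iff.1 (mk_Iio_ord_toType_lt α)).trans_eq
      (mk_ord_toType κ).symm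
  let e := fun α => (he α).some
  obtain ⟨f, hf, hE⟩ := exists_scale (K := (Order.succ κ).ord.ToType)
    (V := fun x => (θ x).ord.ToType) hθlarge (fun x => (hθ x).aleph0_le.trans_eq (hVθ x).symm)
    (fun α x => {β | ∃ h : β < α, e α ⟨β, h⟩ < k x})
    (fun α x => by
      refine ((mk_le_of_injective (f := fun β => (⟨_, β.2.2⟩ : Set.Iio (k x))) ?_).trans_lt
        (Order.lt_succ_of_le (le_max_left _ _))).trans_eq (hVθ x).symm
      intro β β' h
      have h' : (⟨β, β.2.1⟩ : Set.Iio α) = ⟨β', β'.2.1⟩ :=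
        (e α).injective (Subtype.ext_iff.1 h)
      exact Subtype.ext (Subtype.mk.inj h'))
    (fun α β hβ => let ⟨x₀, hx₀⟩ := hk (e α ⟨β, hβ⟩); ⟨x₀, fun x hx => ⟨hβ, hx₀ x hx⟩⟩)
  obtain ⟨i⟩ : Nonempty ((Σ x, (θ x).ord.ToType) ↪ κ.ord.ToType) := by
    rw [← Cardinal.le_def, mk_sigma, mk_ord_toType]
    refine (sum_le_sum _ (fun _ => κ) fun x => (mk_ord_toType _).trans_le (hθκ x).le).trans ?_
    rw [sum_const', hL]
    exact (mul_le_mul_left hsing.le κ).trans_eq (mul_eq_self hκ)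
  refine ⟨fun a x => i ⟨x, f a x⟩, fun Z hZ => ?_⟩
  obtain ⟨b, hb⟩ := exists_forall_mk_setOf_mem_lt hlim
    ((Order.lt_succ κ).trans_eq (cof_ord_toType (isRegular_succ hκ)).symm)
    (hcof.trans_eq hL.symm) (hL.trans_lt hsing) hLI f hf hE (i ⁻¹' Z)
    ((mk_preimage_of_injective i Z i.injective).trans_lt hZ)
  exact Order.lt_succ_iff.1 ((mk_le_mk_of_subset fun a ha => hb a (hL.trans_le ha)).trans_lt
    (mk_Iic_ord_toType_lt (hκ.trans (Order.le_succ κ)) b))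

end Singular

/-- Corollary 3.3: if `κ` is singular, `D'` is `cf κ`-decomposable and `D` is
`κ⁺`-decomposable, then `D × D'` is `κ`-decomposable. -/
theorem prod_decomposable_of_singular {I : Type w} {I' : Type v}
    (κ : Cardinal.{u}) (hκ : ℵ₀ ≤ κ) (hsing : κ.ord.cof < κ)
    (D : Set (Set I)) (D' : Set (Set I'))
    (hD' : Decomposable D' κ.ord.cof)
    (hD : Decomposable D (Order.succ κ)) :
    Decomposable (prodFam D D') κ := by
  obtain ⟨g, hg⟩ := exists_function_of_singular hκ hsing
  obtain ⟨f, hf⟩ := hD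
  obtain ⟨f', hf'⟩ := hD'
  have hout : ∀ c : Cardinal.{u}, Nonempty (c.out ≃ c.ord.ToType) := fun c =>
    Cardinal.eq.1 ((mk_out c).trans (mk_ord_toType c).symm)
  let e := fun c => (hout c).some
  refine ⟨fun p => (e κ).symm (g (e _ (f p.1)) (e _ (f' p.2))), fun Z hZ hmem => ?_⟩
  let Z' : Set κ.ord.ToType := (e κ).symm ⁻¹' Z
  have hZ' : #Z' < κ := (mk_preimage_of_injective _ Z (e κ).symm.injective).trans_lt hZ
  refine hf {a | {i' | (e κ).symm (g (e _ a) (e _ (f' i'))) ∈ Z} ∈ D'}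
    (Order.lt_succ_of_le ?_) hmem
  refine (mk_le_mk_of_subset (t := e _ ⁻¹' {a | κ.ord.cof ≤ #{x | g a x ∈ Z'}})
    fun a ha => ?_).trans ((mk_preimage_of_injective _ _ (e _).injective).trans (hg Z' hZ'))
  by_contra h
  exact hf' (e _ ⁻¹' {x | g (e _ a) x ∈ Z'})
    ((mk_preimage_of_injective _ _ (e _).injective).trans_lt (not_le.1 h)) ha
end

section
/- If λ is a regular infinite cardinal, then a topological space X is λ-compact if and only if X is D-compact, where D = [λ]^λ is the family of all subsets of λ of cardinality λ. -/
open Cardinal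

universe u v w

/-- `p` is a `D`-limit point of the sequence of sets `(F i)_{i ∈ I}`:
`{i : U ∩ F i ≠ ∅} ∈ D` for every neighborhood `U` of `p`. -/
def IsDLimitFam {I : Type w} {X : Type u} [TopologicalSpace X]
    (D : Set (Set I)) (F : I → Set X) (p : X) : Prop :=
  ∀ U ∈ nhds p, {i : I | (U ∩ F i).Nonempty} ∈ D

/-- `p` is a `D`-limit point of the sequence of points `(x i)_{i ∈ I}`:
`{i : x i ∈ U} ∈ D` for every neighborhood `U` of `p`. -/
def IsDLimitPt {I : Type w} {X : Type u} [TopologicalSpace X]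
    (D : Set (Set I)) (x : I → X) (p : X) : Prop :=
  ∀ U ∈ nhds p, {i : I | x i ∈ U} ∈ D

/-- `X` is `D`-compact: every sequence of points of `X` indexed by `I` has a
`D`-limit point. -/
def DCompact {I : Type w} (X : Type u) [TopologicalSpace X]
    (D : Set (Set I)) : Prop :=
  ∀ x : I → X, ∃ p : X, IsDLimitPt D x p

/-- `X` is `𝒻`-`D`-compact: every sequence of members of `𝒻` indexed by `I` has
a `D`-limit point. -/
def FamDCompact {I : Type w} {X : Type u} [TopologicalSpace X]
    (𝒻 : Set (Set X)) (D : Set (Set I)) : Prop :=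
  ∀ F : I → Set X, (∀ i, F i ∈ 𝒻) → ∃ p : X, IsDLimitFam D F p

/-- A map from a type of regular cardinality whose fibers are all small has a range of full
cardinality. -/
theorem mk_range_eq_of_isRegular_of_mk_fiber_lt {I X : Type u} (hreg : (#I).IsRegular)
    (x : I → X) (hx : ∀ p, #(x ⁻¹' {p}) < #I) : #(Set.range x) = #I := by
  refine mk_range_le.antisymm (not_lt.1 fun hlt => ?_)
  obtain ⟨⟨_, i, rfl⟩, hi⟩ := infinite_pigeonhole_card (Set.rangeFactorization x) #I le_rfl
    hreg.aleph0_le (by rwa [hreg.cof_ord])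
  refine (hx (x i)).not_ge (hi.trans (mk_le_mk_of_subset fun j hj => ?_))
  exact congrArg Subtype.val hj

theorem LamCompact.dCompact {I X : Type u} [TopologicalSpace X] (hreg : (#I).IsRegular)
    (h : LamCompact X #I) : DCompact X {A : Set I | #A = #I} := by
  intro x
  by_cases hx : ∃ p, #(x ⁻¹' {p}) = #I
  · obtain ⟨p, hp⟩ := hx
    refine ⟨p, fun U hU => (mk_set_le _).antisymm (hp.ge.trans (mk_le_mk_of_subset ?_))⟩
    rintro i rfl
    exact (mem_of_mem_nhds hU : x i ∈ U)
  · push Not at hx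
    have hrange := mk_range_eq_of_isRegular_of_mk_fiber_lt hreg x
      fun p => (mk_set_le _).lt_of_ne (hx p)
    obtain ⟨p, hp⟩ := h _ hrange
    refine ⟨p, fun U hU => (mk_set_le _).antisymm ?_⟩
    calc #I = #(↥(Set.range x ∩ U)) := ((hp U hU).trans hrange).symm
      _ = #(x '' (x ⁻¹' U)) := by rw [Set.image_preimage_eq_range_inter]
      _ ≤ #(x ⁻¹' U) := mk_image_le

theorem DCompact.lamCompact {I X : Type u} [TopologicalSpace X]
    (h : DCompact X {A : Set I | #A = #I}) : LamCompact X #I := by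
  intro Y hY
  obtain ⟨e⟩ := Cardinal.eq.1 hY.symm
  obtain ⟨p, hp⟩ := h fun i => (e i : X)
  refine ⟨p, fun U hU => (mk_le_mk_of_subset Set.inter_subset_left).antisymm ?_⟩
  rw [hY, ← show #{i : I | (e i : X) ∈ U} = #I from hp U hU]
  exact mk_le_of_injective (f := fun i => ⟨e i.1, (e i.1).2, i.2⟩) fun i j hij =>
    Subtype.ext (e.injective (Subtype.ext (Subtype.mk.inj hij)))

/-- Remark 4.3 (first observation): for `λ` a regular infinite cardinal, `X` is
`λ`-compact if and only if `X` is `D`-compact, where `D = [λ]^λ` is the family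
of all subsets of `λ` of cardinality `λ`. -/
theorem lamCompact_iff_dCompact {X : Type u} [TopologicalSpace X]
    (lam : Cardinal.{u}) (hreg : lam.IsRegular) :
    LamCompact X lam ↔ DCompact X {A : Set lam.out | #A = lam} := by
  obtain ⟨I, rfl⟩ : ∃ I : Type u, lam = #I := ⟨lam.out, (mk_out lam).symm⟩
  have hout : #(#I).out = #I := mk_out _
  constructor
  · intro h
    simpa only [hout] using LamCompact.dCompact (I := (#I).out) (by rwa [hout]) (by rwa [hout])
  · intro h
    simpa only [hout] using DCompact.lamCompact (I := (#I).out) (by simpa only [hout] using h)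
end

section
/- If μ is a regular infinite cardinal, then a topological space X is 𝒻-μ-compact if and only if X is 𝒻-D'-compact, where D' = [μ]^μ is the family of all subsets of μ of cardinality μ. -/
open Cardinal

universe u v w

/-- A sequence of nonempty sets indexed by a type of regular cardinality with fewer than `#I` distinct
terms has a limit point: some term is repeated `#I` times. -/
theorem exists_isDLimitFam_of_mk_range_lt {I X : Type u} [TopologicalSpace X] (F : I → Set X)
    (hreg : (#I).IsRegular) (hne : ∀ i, (F i).Nonempty) (hlt : #(Set.range F) < #I) :
    ∃ p : X, IsDLimitFam {A : Set I | #A = #I} F p := by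
  obtain ⟨⟨_, i, rfl⟩, ha⟩ := Cardinal.infinite_pigeonhole (Set.rangeFactorization F)
    hreg.aleph0_le (by rwa [hreg.cof_ord])
  obtain ⟨p, hp⟩ := hne i
  refine ⟨p, fun U hU => le_antisymm (mk_set_le _) ?_⟩
  rw [← ha]
  refine mk_le_mk_of_subset fun j hj => ?_
  have hj' : F j = F i := congrArg Subtype.val hj
  exact ⟨p, mem_of_mem_nhds hU, hj' ▸ hp⟩

/-- A complete accumulation point of the range of a sequence with `#I` distinct terms is a limit
point of the sequence. -/
theorem IsCapFamily.isDLimitFam {I X : Type u} [TopologicalSpace X] {F : I → Set X} {p : X}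
    (hp : IsCapFamily p (Set.range F)) (hcard : #(Set.range F) = #I) :
    IsDLimitFam {A : Set I | #A = #I} F p := by
  refine fun U hU => le_antisymm (mk_set_le _) ?_
  rw [← hcard, ← hp U hU]
  refine (mk_le_mk_of_subset ?_).trans (mk_image_le (f := F))
  rintro _ ⟨⟨i, rfl⟩, hi⟩
  exact ⟨i, by simpa only [Set.mem_ofPred_eq, Set.inter_comm U] using hi, rfl⟩

/-- A limit point of an injective sequence is a complete accumulation point of its range. -/
theorem IsDLimitFam.isCapFamily {I X : Type u} [TopologicalSpace X] {F : I → Set X} {p : X}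
    (hp : IsDLimitFam {A : Set I | #A = #I} F p) (hF : Function.Injective F) :
    IsCapFamily p (Set.range F) := by
  intro U hU
  refine le_antisymm (mk_le_mk_of_subset fun Y hY => hY.1) ?_
  have h : #{i : I | (U ∩ F i).Nonempty} = #I := hp U hU
  rw [mk_range_eq F hF, ← h, ← mk_image_eq hF]
  refine mk_le_mk_of_subset ?_
  rintro _ ⟨i, hi, rfl⟩
  exact ⟨⟨i, rfl⟩, Set.inter_comm _ _ ▸ hi⟩

/-- Remark 4.3 (second observation): for `μ` a regular infinite cardinal, `X`
is `𝒻`-`μ`-compact if and only if `X` is `𝒻`-`D'`-compact, where `D' = [μ]^μ`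
is the family of all subsets of `μ` of cardinality `μ`. -/
theorem famCompact_iff_famDCompact {X : Type u} [TopologicalSpace X]
    (𝒻 : Set (Set X)) (h𝒻ne : 𝒻.Nonempty) (h𝒻 : ∅ ∉ 𝒻)
    (μ : Cardinal.{u}) (hreg : μ.IsRegular) :
    FamCompact 𝒻 μ ↔ FamDCompact 𝒻 {A : Set μ.out | #A = μ} := by
  have hμ : #μ.out = μ := mk_out μ
  have hD : {A : Set μ.out | #A = μ} = {A : Set μ.out | #A = #μ.out} := by rw [hμ]
  rw [hD]
  constructor
  · intro h F hF
    have hle : #(Set.range F) ≤ #μ.out := mk_range_le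
    rcases hle.lt_or_eq with hlt | heq
    · refine exists_isDLimitFam_of_mk_range_lt F (hμ.symm ▸ hreg) (fun i => ?_) hlt
      exact Set.nonempty_iff_ne_empty.2 fun hi => h𝒻 (hi ▸ hF i)
    · obtain ⟨p, hp⟩ := h _ (Set.range_subset_iff.2 hF) (heq.trans hμ)
      exact ⟨p, hp.isDLimitFam heq⟩
  · intro h 𝒴 h𝒴 hcard
    obtain ⟨e⟩ := Cardinal.eq.1 (hμ.trans hcard.symm)
    obtain ⟨p, hp⟩ := h (fun i => e i) fun i => h𝒴 (e i).2
    have hrange : Set.range (fun i => (e i : Set X)) = 𝒴 := by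
      rw [← Function.comp_def, e.surjective.range_comp, Subtype.range_coe]
    exact ⟨p, hrange ▸ hp.isCapFamily (Subtype.val_injective.comp e.injective)⟩
end
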